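/- Let R be an A-order in D containing π. Then there exist a Drinfeld module ψ over k and an isogeny u : φ → ψ with u⁻¹·End_k(ψ)·u = R if and only if R is locally maximal at π. -/

import Mathlib

/- Framework: Drinfeld modules over a finite A-field `k`, realized concretely.
`k{τ}` is the subring of additive endomorphisms of an algebraic closure of `k`
generated by the `q`-power Frobenius `τ` and multiplications by elements of `k`. -/

open Polynomial

noncomputable section

namespace Drinfeld

variable (p m : ℕ) [Fact p.Prime]
variable (Fq k : Type) [Field Fq] [Fintype Fq] [Field k] [Fintype k] [CharP k p]

/-- A fixed algebraic closure of `k`. -/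
abbrev Kb := AlgebraicClosure k

variable (hFq : Fintype.card Fq = p ^ m)

/-- The `q`-power Frobenius `τ : x ↦ x^q` as an additive endomorphism of `Kb k`. -/
def tau : AddMonoid.End (Kb k) where
  toFun x := x ^ Fintype.card Fq
  map_zero' := zero_pow Fintype.card_ne_zero
  map_add' x y := by
    haveI : CharP (Kb k) p :=
      charP_of_injective_algebraMap (algebraMap k (Kb k)).injective p
    simp only [hFq]
    exact add_pow_char_pow x y p m

/-- Multiplication by `c ∈ k` as an additive endomorphism of `Kb k`. -/
def ml (c : k) : AddMonoid.End (Kb k) :=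
  AddMonoidHom.mulLeft (algebraMap k (Kb k) c)

/-- The twisted polynomial ring `k{τ}`. -/
def skewPoly : Subring (AddMonoid.End (Kb k)) :=
  Subring.closure (insert (tau p m Fq k hFq) (Set.range (ml k)))

/-- The additive endomorphism `Σᵢ cᵢ ∘ τ^i` attached to a finitely supported
family of coefficients `c : ℕ →₀ k`. -/
def ofCoeffs (c : ℕ →₀ k) : AddMonoid.End (Kb k) :=
  c.sum fun i a => ml k a * tau p m Fq k hFq ^ i

/-- A Drinfeld module of rank `r` over the `A`-field `(k, γ)`:
a ring homomorphism `φ : A = Fq[T] → k{τ}` with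
`φ_a = γ(a) + g₁(a) τ + ⋯ + g_{r·deg a}(a) τ^{r·deg a}` and `g_{r · deg a}(a) ≠ 0`. -/
structure DrinfeldModule (γ : Polynomial Fq →+* k) (r : ℕ) : Type where
  toRingHom : Polynomial Fq →+* AddMonoid.End (Kb k)
  coeffs : Polynomial Fq → ℕ →₀ k
  eq_ofCoeffs : ∀ a, toRingHom a = ofCoeffs p m Fq k hFq (coeffs a)
  coeff_zero : ∀ a, coeffs a 0 = γ a
  coeff_top : ∀ a, a ≠ 0 → coeffs a (r * a.natDegree) ≠ 0
  coeff_eq_zero : ∀ a i, r * a.natDegree < i → coeffs a i = 0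

variable {γ : Polynomial Fq →+* k} {r : ℕ}

/-- The endomorphism ring `End_k(φ)`: the centralizer of `φ(A)` in `k{τ}`. -/
def EndRing (φ : DrinfeldModule p m Fq k hFq γ r) : Subring (AddMonoid.End (Kb k)) :=
  skewPoly p m Fq k hFq ⊓ Subring.centralizer (Set.range ⇑φ.toRingHom)

/-- `u` is an isogeny `φ → ψ`: a nonzero element of `k{τ}` with `u φ_a = ψ_a u`. -/
def IsIsogeny (φ ψ : DrinfeldModule p m Fq k hFq γ r) (u : AddMonoid.End (Kb k)) : Prop :=
  u ≠ 0 ∧ u ∈ skewPoly p m Fq k hFq ∧ ∀ a, u * φ.toRingHom a = ψ.toRingHom a * u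

/-- Two Drinfeld modules are isomorphic when some isogeny between them lies in `k^×`. -/
def Isomorphic (φ ψ : DrinfeldModule p m Fq k hFq γ r) : Prop :=
  ∃ c : k, c ≠ 0 ∧ ∀ a, ml k c * φ.toRingHom a = ψ.toRingHom a * ml k c

/-- The left ideal `k{τ}·s` of `k{τ}` generated by a subset `s`. -/
def leftSpan (s : Set (AddMonoid.End (Kb k))) : AddSubgroup (AddMonoid.End (Kb k)) :=
  AddSubgroup.closure {y | ∃ w ∈ skewPoly p m Fq k hFq, ∃ x ∈ s, y = w * x}

/-- `u` generates the left ideal `k{τ}·s` of `k{τ}`: `k{τ}s = k{τ}u`.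
(Such a `u = u_I` exists by the right division algorithm in `k{τ}`.) -/
def IsIdealGen (s : Set (AddMonoid.End (Kb k))) (u : AddMonoid.End (Kb k)) : Prop :=
  u ∈ skewPoly p m Fq k hFq ∧
    (leftSpan p m Fq k hFq s : Set (AddMonoid.End (Kb k))) =
      {y | ∃ w ∈ skewPoly p m Fq k hFq, y = w * u}

/-- `I` is an ideal of the (commutative) subring `E` of `k{τ}`. -/
def IsIdealOf (E : Subring (AddMonoid.End (Kb k))) (I : Set (AddMonoid.End (Kb k))) : Prop :=
  I ⊆ E ∧ (0 : AddMonoid.End (Kb k)) ∈ I ∧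
    (∀ x ∈ I, ∀ y ∈ I, x + y ∈ I) ∧ (∀ x ∈ I, -x ∈ I) ∧
    (∀ e ∈ E, ∀ x ∈ I, e * x ∈ I) ∧ (∀ e ∈ E, ∀ x ∈ I, x * e ∈ I)

/-- Membership in `D = End_k(φ) ⊗_A F = Frac(End_k(φ))` for an element of `k{τ}`:
`x ∈ D` iff `x·φ_a ∈ End_k(φ)` for some nonzero `a ∈ A`, i.e. `x = e/φ_a`. -/
def MemD (φ : DrinfeldModule p m Fq k hFq γ r) (x : AddMonoid.End (Kb k)) : Prop :=
  ∃ a : Polynomial Fq, a ≠ 0 ∧ x * φ.toRingHom a ∈ EndRing p m Fq k hFq φ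

/-- `I` is a kernel ideal: `(k{τ}I) ∩ D = I`. -/
def IsKernelIdeal (φ : DrinfeldModule p m Fq k hFq γ r)
    (I : Set (AddMonoid.End (Kb k))) : Prop :=
  {x | x ∈ leftSpan p m Fq k hFq I ∧ MemD p m Fq k hFq φ x} = I

/-- The subring `A[π] = φ(A)[π]` of `k{τ}`, where `π = τ^n` is the Frobenius of `k`. -/
def ApirOp (n : ℕ) (φ : DrinfeldModule p m Fq k hFq γ r) :
    Subring (AddMonoid.End (Kb k)) :=
  Subring.closure (insert (tau p m Fq k hFq ^ n) (Set.range ⇑φ.toRingHom))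

/-- `φ` has height `H` (relative to the monic generator `P` of `𝔭 = ker γ`):
the smallest `τ`-degree of a nonzero term of `φ_P` equals `H · deg P`, i.e. `φ_P` is
right-divisible by `τ^{H·deg P}` but not by `τ^{H·deg P + 1}`. -/
def HasHeight (φ : DrinfeldModule p m Fq k hFq γ r) (P : Polynomial Fq) (H : ℕ) : Prop :=
  (∃ u ∈ skewPoly p m Fq k hFq,
      φ.toRingHom P = u * tau p m Fq k hFq ^ (H * P.natDegree)) ∧
    ¬∃ u ∈ skewPoly p m Fq k hFq,
      φ.toRingHom P = u * tau p m Fq k hFq ^ (H * P.natDegree + 1)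

/-- `I = J·u` for some nonzero `u ∈ D = Frac(E)`, written as `u = e/φ_a` with `e ∈ E`,
`a ∈ A` both nonzero; equivalently `I·φ_a = J·e`. -/
def LinEquiv (φ : DrinfeldModule p m Fq k hFq γ r) (E : Subring (AddMonoid.End (Kb k)))
    (I J : Set (AddMonoid.End (Kb k))) : Prop :=
  ∃ e ∈ E, e ≠ 0 ∧ ∃ a : Polynomial Fq, a ≠ 0 ∧
    (fun x => x * φ.toRingHom a) '' I = (fun y => y * e) '' J

/-- The additive polynomial `u(X) ∈ k[X]` attached to `u ∈ k{τ}` (the unique polynomial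
inducing `u` on the algebraic closure, if it exists; junk value `0` otherwise). -/
def toPoly (u : AddMonoid.End (Kb k)) : Polynomial k :=
  letI := Classical.propDecidable (∃ P : Polynomial k, ∀ x : Kb k, Polynomial.aeval x P = u x)
  if h : ∃ P : Polynomial k, ∀ x : Kb k, Polynomial.aeval x P = u x then h.choose else 0

end Drinfeld

set_option linter.unusedSectionVars false

namespace Drinfeld

open scoped TensorProduct

variable (p m : ℕ) [Fact p.Prime] (Fq k : Type) [Field Fq] [Fintype Fq]
  [Field k] [Fintype k] [CharP k p] (hFq : Fintype.card Fq = p ^ m)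
  {γ : Polynomial Fq →+* k} {r : ℕ}

theorem ofCoeffs_mem_skewPoly (c : ℕ →₀ k) :
    ofCoeffs p m Fq k hFq c ∈ skewPoly p m Fq k hFq := by
  classical
  rw [ofCoeffs, Finsupp.sum]
  refine Subring.sum_mem _ fun i _ => ?_
  exact Subring.mul_mem _
    (Subring.subset_closure (Set.mem_insert_iff.2 (Or.inr ⟨_, rfl⟩)))
    (Subring.pow_mem _ (Subring.subset_closure (Set.mem_insert _ _)) i)

theorem mem_EndRing_of_range (φ : DrinfeldModule p m Fq k hFq γ r) (a : Polynomial Fq) :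
    φ.toRingHom a ∈ EndRing p m Fq k hFq φ := by
  rw [EndRing, Subring.mem_inf]
  constructor
  · rw [φ.eq_ofCoeffs a]
    exact ofCoeffs_mem_skewPoly p m Fq k hFq _
  · rw [Subring.mem_centralizer_iff]
    rintro _ ⟨b, rfl⟩
    rw [← map_mul, ← map_mul, mul_comm]

/-- `End_k(φ)` with its (assumed) commutative ring structure. -/
def endCommRing (φ : DrinfeldModule p m Fq k hFq γ r)
    (hcomm : ∀ x ∈ EndRing p m Fq k hFq φ, ∀ y ∈ EndRing p m Fq k hFq φ, x * y = y * x) :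
    CommRing ↥(EndRing p m Fq k hFq φ) :=
  { (inferInstance : Ring ↥(EndRing p m Fq k hFq φ)) with
    mul_comm := fun a b => Subtype.ext (hcomm a.1 a.2 b.1 b.2) }

/-- The structure map `A = Fq[T] → E = End_k(φ)`. -/
def toEnd (φ : DrinfeldModule p m Fq k hFq γ r) :
    Polynomial Fq →+* ↥(EndRing p m Fq k hFq φ) :=
  φ.toRingHom.codRestrict (EndRing p m Fq k hFq φ)
    (mem_EndRing_of_range p m Fq k hFq φ)

/-- `E = End_k(φ)` is Gorenstein: for every nonzero prime `𝔩 = (L)` of `A`, with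
`A_𝔩` the `𝔩`-adic completion of `A` and `E_𝔩 = E ⊗_A A_𝔩`, the dual
`Hom_{A_𝔩}(E_𝔩, A_𝔩)` is a free `E_𝔩`-module of rank 1; freeness on a generator `g` is
expressed by: every `f` equals `e • g : x ↦ g(e·x)` for some `e ∈ E_𝔩`, and `e • g = 0`
implies `e = 0`. -/
def IsGorensteinEnd (φ : DrinfeldModule p m Fq k hFq γ r)
    (hcomm : ∀ x ∈ EndRing p m Fq k hFq φ, ∀ y ∈ EndRing p m Fq k hFq φ, x * y = y * x) :
    Prop :=
  ∀ L : Polynomial Fq, L.Monic → Irreducible L →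
    letI : CommRing ↥(EndRing p m Fq k hFq φ) := endCommRing p m Fq k hFq φ hcomm
    letI : Algebra (Polynomial Fq) ↥(EndRing p m Fq k hFq φ) :=
      (toEnd p m Fq k hFq φ).toAlgebra
    ∃ g : (AdicCompletion (Ideal.span {L}) (Polynomial Fq)
            ⊗[Polynomial Fq] ↥(EndRing p m Fq k hFq φ))
          →ₗ[AdicCompletion (Ideal.span {L}) (Polynomial Fq)]
          AdicCompletion (Ideal.span {L}) (Polynomial Fq),
      (∀ f : (AdicCompletion (Ideal.span {L}) (Polynomial Fq)
            ⊗[Polynomial Fq] ↥(EndRing p m Fq k hFq φ))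
          →ₗ[AdicCompletion (Ideal.span {L}) (Polynomial Fq)]
          AdicCompletion (Ideal.span {L}) (Polynomial Fq),
        ∃ e, ∀ x, f x = g (e * x)) ∧
      (∀ e, (∀ x, g (e * x) = 0) → e = 0)

end Drinfeld

namespace Drinfeld

section AddPoly

/-- The `q`-polynomial `Σ aᵢ X^(q^i)`. -/
def addPoly {L : Type} [Field L] (q : ℕ) (a : ℕ →₀ L) : L[X] :=
  a.sum fun i x => monomial (q ^ i) x

variable {L : Type} [Field L] {q : ℕ} (a : ℕ →₀ L)

theorem addPoly_coeff (hq : 1 < q) (i : ℕ) : (addPoly q a).coeff (q ^ i) = a i := by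
  classical
  rw [addPoly, Finsupp.sum, finsetSum_coeff]
  simp only [coeff_monomial, (Nat.pow_right_injective hq).eq_iff]
  simp only [Finset.sum_ite_eq', Finsupp.mem_support_iff, ite_eq_left_iff, not_not]
  exact Eq.symm

theorem addPoly_eq_zero_iff (hq : 1 < q) : addPoly q a = 0 ↔ a = 0 := by
  refine ⟨fun h => ?_, fun h => by simp [h, addPoly]⟩
  ext i
  rw [← addPoly_coeff a hq, h]
  simp

theorem addPoly_natDegree_le (hq : 1 < q) {d : ℕ} (h : ∀ i, d < i → a i = 0) :
    (addPoly q a).natDegree ≤ q ^ d := by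
  refine natDegree_sum_le_of_forall_le _ _ fun i hi => (natDegree_monomial_le _).trans ?_
  refine Nat.pow_le_pow_right hq.le ?_
  by_contra hlt
  exact Finsupp.mem_support_iff.1 hi (h i (not_le.1 hlt))

theorem addPoly_natDegree_lt (hq : 1 < q) {d : ℕ} (h : ∀ i, d ≤ i → a i = 0) :
    (addPoly q a).natDegree < q ^ d := by
  cases d with
  | zero =>
    have : a = 0 := by ext i; exact h i (Nat.zero_le _)
    simp [this, addPoly]
  | succ d =>
    exact (addPoly_natDegree_le a hq fun i hi => h i hi).trans_lt (Nat.pow_lt_pow_right hq d.lt_succ_self)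

theorem addPoly_natDegree_eq (hq : 1 < q) {d : ℕ} (hd : a d ≠ 0) (h : ∀ i, d < i → a i = 0) :
    (addPoly q a).natDegree = q ^ d :=
  le_antisymm (addPoly_natDegree_le a hq h)
    (le_natDegree_of_ne_zero (by rwa [addPoly_coeff a hq]))

theorem addPoly_derivative (hq0 : (q : L) = 0) :
    derivative (addPoly q a) = C (a 0) := by
  classical
  rw [addPoly, Finsupp.sum, derivative_sum]
  have key : ∀ i ∈ a.support, derivative (monomial (q ^ i) (a i)) = if i = 0 then C (a 0) else 0 := by
    intro i _
    rw [derivative_monomial]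
    rcases i with _ | i
    · simp
    · simp [pow_succ, hq0]
  rw [Finset.sum_congr rfl key]
  simp only [Finset.sum_ite_eq', Finsupp.mem_support_iff]
  split_ifs with h
  · rfl
  · simp [not_not.1 h]

theorem exists_lead {M : Type} [Zero M] {a : ℕ →₀ M} (ha : a ≠ 0) :
    ∃ d, a d ≠ 0 ∧ ∀ i, d < i → a i = 0 := by
  have hne : a.support.Nonempty := Finsupp.support_nonempty_iff.2 ha
  refine ⟨a.support.max' hne, Finsupp.mem_support_iff.1 (a.support.max'_mem hne), fun i hi => ?_⟩
  by_contra h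
  exact (a.support.le_max' i (Finsupp.mem_support_iff.2 h)).not_gt hi

theorem exists_bound {M : Type} [Zero M] (a : ℕ →₀ M) : ∃ d, ∀ i, d ≤ i → a i = 0 := by
  by_cases ha : a = 0
  · exact ⟨0, by simp [ha]⟩
  · obtain ⟨d, -, h⟩ := exists_lead ha
    exact ⟨d + 1, fun i hi => h i hi⟩

end AddPoly

section Skew

variable (p m : ℕ) [Fact p.Prime] (Fq k : Type) [Field Fq] [Fintype Fq]
  [Field k] [Fintype k] [CharP k p] (hFq : Fintype.card Fq = p ^ m)

local notation "q" => Fintype.card Fq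
local notation "τ" => tau p m Fq k hFq
local notation "SK" => skewPoly p m Fq k hFq
local notation "oc" => ofCoeffs p m Fq k hFq

/-- Coefficients in `k` viewed in the algebraic closure. -/
def liftCoeffs (c : ℕ →₀ k) : ℕ →₀ Kb k := c.mapRange (algebraMap k (Kb k)) (map_zero _)

theorem liftCoeffs_apply (c : ℕ →₀ k) (i : ℕ) :
    liftCoeffs k c i = algebraMap k (Kb k) (c i) := rfl

theorem end_mul_apply (x y : AddMonoid.End (Kb k)) (w : Kb k) : (x * y) w = x (y w) := rfl

theorem end_add_apply (x y : AddMonoid.End (Kb k)) (w : Kb k) : (x + y) w = x w + y w := rfl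

theorem end_sub_apply (x y : AddMonoid.End (Kb k)) (w : Kb k) : (x - y) w = x w - y w := rfl

theorem end_sum_apply {ι : Type} (s : Finset ι) (f : ι → AddMonoid.End (Kb k)) (w : Kb k) :
    (∑ i ∈ s, f i) w = ∑ i ∈ s, f i w :=
  AddMonoidHom.finsetSum_apply f s w

theorem tau_apply (w : Kb k) : τ w = w ^ q := rfl

theorem ml_apply (c : k) (w : Kb k) : ml k c w = algebraMap k (Kb k) c * w := rfl

theorem tau_pow_apply (i : ℕ) (w : Kb k) : (τ ^ i) w = w ^ q ^ i := by
  induction i generalizing w with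
  | zero => simp
  | succ i ih =>
    rw [pow_succ, end_mul_apply, ih, tau_apply, ← pow_mul, ← pow_succ']

theorem one_lt_q : 1 < q := Fintype.one_lt_card

theorem q_cast_eq_zero (hFq : Fintype.card Fq = p ^ m) : ((q : ℕ) : Kb k) = 0 := by
  have : CharP (Kb k) p := charP_of_injective_algebraMap (algebraMap k (Kb k)).injective p
  have hm : m ≠ 0 := by
    rintro rfl
    have := one_lt_q Fq
    simp [hFq] at this
  rw [hFq, Nat.cast_pow, CharP.cast_eq_zero, zero_pow hm]

theorem ofCoeffs_apply (c : ℕ →₀ k) (w : Kb k) :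
    oc c w = (addPoly q (liftCoeffs k c)).eval w := by
  rw [addPoly, liftCoeffs, Finsupp.sum_mapRange_index (by simp), ofCoeffs, Finsupp.sum, Finsupp.sum,
    end_sum_apply, eval_finsetSum]
  refine Finset.sum_congr rfl fun i _ => ?_
  rw [end_mul_apply, tau_pow_apply, ml_apply, eval_monomial]

theorem ml_zero : ml k 0 = 0 := by ext w; simp [ml_apply]

theorem ml_add (a b : k) : ml k (a + b) = ml k a + ml k b := by
  ext w; simp [ml_apply, end_add_apply, add_mul]

theorem ml_mul (a b : k) : ml k (a * b) = ml k a * ml k b := by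
  ext w; simp [ml_apply, end_mul_apply, mul_assoc]

theorem ml_one : ml k 1 = 1 := by ext w; simp [ml_apply]

theorem ofCoeffs_zero : oc 0 = 0 := by simp [ofCoeffs]

theorem ofCoeffs_add (c d : ℕ →₀ k) : oc (c + d) = oc c + oc d :=
  Finsupp.sum_add_index' (fun i => by simp [ml_zero]) fun i a b => by rw [ml_add, add_mul]

theorem ofCoeffs_single (i : ℕ) (a : k) : oc (Finsupp.single i a) = ml k a * τ ^ i :=
  Finsupp.sum_single_index (by simp [ml_zero])

theorem ofCoeffs_neg (c : ℕ →₀ k) : oc (-c) = -oc c := by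
  rw [eq_neg_iff_add_eq_zero, ← ofCoeffs_add, neg_add_cancel, ofCoeffs_zero]

theorem ofCoeffs_sub (c d : ℕ →₀ k) : oc (c - d) = oc c - oc d := by
  rw [sub_eq_add_neg, ofCoeffs_add, ofCoeffs_neg, ← sub_eq_add_neg]

theorem liftCoeffs_injective : Function.Injective (liftCoeffs k) :=
  Finsupp.mapRange_injective _ (map_zero _) (algebraMap k (Kb k)).injective

theorem addPoly_eq_of_ofCoeffs_eq {c d : ℕ →₀ k} (h : oc c = oc d) : c = d := by
  rw [← sub_eq_zero]
  have h0 : oc (c - d) = 0 := by rw [ofCoeffs_sub, h, sub_self]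
  apply liftCoeffs_injective
  rw [show liftCoeffs k (0 : ℕ →₀ k) = 0 by simp [liftCoeffs], ← addPoly_eq_zero_iff _ (one_lt_q Fq)]
  refine Polynomial.funext fun w => ?_
  rw [← ofCoeffs_apply p m Fq k hFq, h0]
  simp

theorem ofCoeffs_eq_zero_iff {c : ℕ →₀ k} : oc c = 0 ↔ c = 0 :=
  ⟨fun h => addPoly_eq_of_ofCoeffs_eq p m Fq k hFq (h.trans (ofCoeffs_zero p m Fq k hFq).symm),
    fun h => by rw [h, ofCoeffs_zero]⟩

theorem tau_pow_mul_ml (i : ℕ) (a : k) : τ ^ i * ml k a = ml k (a ^ q ^ i) * τ ^ i := by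
  ext w
  simp only [end_mul_apply, ml_apply, tau_pow_apply, map_pow, mul_pow]

theorem tau_mem : τ ∈ SK := Subring.subset_closure (Set.mem_insert _ _)

theorem ml_mem (a : k) : ml k a ∈ SK :=
  Subring.subset_closure (Set.mem_insert_iff.2 (Or.inr ⟨_, rfl⟩))

/-- The coefficients of `aτ^j · Σ cᵢτ^i`. -/
def mulMon (a : k) (j : ℕ) (c : ℕ →₀ k) : ℕ →₀ k :=
  Finsupp.mapDomain (· + j) (c.mapRange (fun x => a * x ^ q ^ j)
    (by rw [zero_pow (pow_ne_zero _ (one_lt_q Fq).ne_bot), mul_zero]))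

theorem mulMon_apply (a : k) (j : ℕ) (c : ℕ →₀ k) (i : ℕ) :
    mulMon Fq k a j c (i + j) = a * c i ^ q ^ j := by
  rw [mulMon, Finsupp.mapDomain_apply (add_left_injective j), Finsupp.mapRange_apply]

theorem mulMon_spec (a : k) (j : ℕ) (c : ℕ →₀ k) :
    ml k a * τ ^ j * oc c = oc (mulMon Fq k a j c) := by
  rw [mulMon]
  conv_rhs => rw [ofCoeffs]
  rw [Finsupp.sum_mapDomain_index (fun i => by simp [ml_zero]) (fun i a b => by rw [ml_add, add_mul]),
    Finsupp.sum_mapRange_index (by simp [ml_zero]), ofCoeffs, Finsupp.sum, Finsupp.sum, Finset.mul_sum]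
  refine Finset.sum_congr rfl fun i _ => ?_
  rw [ml_mul, add_comm i j, pow_add, mul_assoc, ← mul_assoc (τ ^ j), tau_pow_mul_ml]
  simp only [mul_assoc]

theorem ofCoeffs_mul_tau_pow (c : ℕ →₀ k) (j : ℕ) :
    oc c * τ ^ j = oc (Finsupp.mapDomain (· + j) c) := by
  conv_rhs => rw [ofCoeffs]
  rw [Finsupp.sum_mapDomain_index (fun i => by simp [ml_zero]) (fun i a b => by rw [ml_add, add_mul]),
    ofCoeffs, Finsupp.sum, Finsupp.sum, Finset.sum_mul]
  simp only [mul_assoc, pow_add]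

theorem exists_ofCoeffs_mul (c d : ℕ →₀ k) : ∃ b, oc c * oc d = oc b := by
  induction c using Finsupp.induction_linear with
  | zero => exact ⟨0, by simp [ofCoeffs_zero]⟩
  | add f g hf hg =>
    obtain ⟨a, ha⟩ := hf
    obtain ⟨b, hb⟩ := hg
    exact ⟨a + b, by rw [ofCoeffs_add, add_mul, ha, hb, ofCoeffs_add]⟩
  | single i a => exact ⟨mulMon Fq k a i d, by rw [ofCoeffs_single, mulMon_spec]⟩

theorem mem_skewPoly_iff {x : AddMonoid.End (Kb k)} : x ∈ SK ↔ ∃ c, x = oc c := by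
  refine ⟨fun h => ?_, fun ⟨c, hc⟩ => hc ▸ ofCoeffs_mem_skewPoly p m Fq k hFq c⟩
  refine Subring.closure_induction (p := fun x _ => ∃ c, x = oc c) ?_ ?_ ?_ ?_ ?_ ?_ h
  · rintro x (rfl | ⟨a, rfl⟩)
    · exact ⟨Finsupp.single 1 1, by rw [ofCoeffs_single, ml_one, pow_one, one_mul]⟩
    · exact ⟨Finsupp.single 0 a, by rw [ofCoeffs_single, pow_zero, mul_one]⟩
  · exact ⟨0, (ofCoeffs_zero p m Fq k hFq).symm⟩
  · exact ⟨Finsupp.single 0 1, by rw [ofCoeffs_single, pow_zero, mul_one, ml_one]⟩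
  · rintro _ _ _ _ ⟨c, rfl⟩ ⟨d, rfl⟩
    exact ⟨c + d, (ofCoeffs_add p m Fq k hFq c d).symm⟩
  · rintro _ _ ⟨c, rfl⟩
    exact ⟨-c, (ofCoeffs_neg p m Fq k hFq c).symm⟩
  · rintro _ _ _ _ ⟨c, rfl⟩ ⟨d, rfl⟩
    exact exists_ofCoeffs_mul p m Fq k hFq c d

/-- Composition of skew polynomials corresponds to composition of `q`-polynomials. -/
theorem addPoly_comp {b c d : ℕ →₀ k} (h : oc b * oc c = oc d) :
    (addPoly q (liftCoeffs k b)).comp (addPoly q (liftCoeffs k c)) = addPoly q (liftCoeffs k d) := by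
  refine Polynomial.funext fun w => ?_
  rw [eval_comp, ← ofCoeffs_apply p m Fq k hFq, ← ofCoeffs_apply p m Fq k hFq,
    ← ofCoeffs_apply p m Fq k hFq, ← h, end_mul_apply]

theorem coeff_zero_mul {b c d : ℕ →₀ k} (h : oc b * oc c = oc d) : d 0 = b 0 * c 0 := by
  have := congrArg derivative (addPoly_comp p m Fq k hFq h)
  have hq0 := q_cast_eq_zero p m Fq k hFq
  rw [derivative_comp, addPoly_derivative _ hq0, addPoly_derivative _ hq0,
    addPoly_derivative _ hq0, C_comp, ← C_mul] at this
  apply (algebraMap k (Kb k)).injective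
  rw [map_mul, mul_comm]
  exact (C_injective this).symm

theorem surjective_of_ne_zero {x : AddMonoid.End (Kb k)} (hx : x ∈ SK) (h0 : x ≠ 0) :
    Function.Surjective x := by
  obtain ⟨c, rfl⟩ := (mem_skewPoly_iff p m Fq k hFq).1 hx
  intro w
  have hc : liftCoeffs k c ≠ 0 := by
    intro h
    exact h0 ((ofCoeffs_eq_zero_iff p m Fq k hFq).2 (liftCoeffs_injective k (h.trans (by simp [liftCoeffs]))))
  obtain ⟨d, hd, hd'⟩ := exists_lead hc
  have hdeg := addPoly_natDegree_eq _ (one_lt_q Fq) hd hd'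
  obtain ⟨y, hy⟩ := IsAlgClosed.exists_root (addPoly q (liftCoeffs k c) - C w) (by
    intro h
    have := natDegree_eq_of_degree_eq_some h
    rw [natDegree_sub_C, hdeg] at this
    exact pow_ne_zero _ (one_lt_q Fq).ne_bot this)
  refine ⟨y, ?_⟩
  rw [ofCoeffs_apply]
  simpa [IsRoot, sub_eq_zero] using hy

theorem skew_eq_zero_of_mul {x y : AddMonoid.End (Kb k)} (hy : y ∈ SK)
    (hy0 : y ≠ 0) (h : x * y = 0) : x = 0 := by
  ext w
  obtain ⟨v, rfl⟩ := surjective_of_ne_zero p m Fq k hFq hy hy0 w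
  simpa using DFunLike.congr_fun h v

instance skewPoly_noZeroDivisors : NoZeroDivisors SK where
  eq_zero_or_eq_zero_of_mul_eq_zero {x y} h := by
    by_contra hne
    push Not at hne
    refine hne.1 (Subtype.ext (skew_eq_zero_of_mul p m Fq k hFq y.2 (fun h => hne.2 (Subtype.ext h)) ?_))
    exact congrArg Subtype.val h

instance skewPoly_nontrivial : Nontrivial SK :=
  ⟨0, 1, fun h => by simpa using DFunLike.congr_fun (congrArg Subtype.val h) (1 : Kb k)⟩

instance skewPoly_isDomain : IsDomain SK := NoZeroDivisors.to_isDomain _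

/-- The coefficients of a skew polynomial. -/
def cf (x : SK) : ℕ →₀ k := ((mem_skewPoly_iff p m Fq k hFq).1 x.2).choose

theorem ofCoeffs_cf (x : SK) : oc (cf p m Fq k hFq x) = x :=
  ((mem_skewPoly_iff p m Fq k hFq).1 x.2).choose_spec.symm

/-- The constant coefficient of a skew polynomial. -/
def constCoeff : SK →+* k where
  toFun x := cf p m Fq k hFq x 0
  map_one' := by
    rw [addPoly_eq_of_ofCoeffs_eq p m Fq k hFq (c := cf p m Fq k hFq 1) (d := Finsupp.single 0 1)]
    · simp
    · rw [ofCoeffs_cf, ofCoeffs_single, ml_one]; simp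
  map_zero' := by
    rw [addPoly_eq_of_ofCoeffs_eq p m Fq k hFq (c := cf p m Fq k hFq 0) (d := 0)]
    · simp
    · rw [ofCoeffs_cf, ofCoeffs_zero]; simp
  map_add' x y := by
    rw [addPoly_eq_of_ofCoeffs_eq p m Fq k hFq (c := cf p m Fq k hFq (x + y))
      (d := cf p m Fq k hFq x + cf p m Fq k hFq y)]
    · simp
    · rw [ofCoeffs_cf, ofCoeffs_add, ofCoeffs_cf, ofCoeffs_cf]; simp
  map_mul' x y := by
    refine coeff_zero_mul p m Fq k hFq ?_
    rw [ofCoeffs_cf, ofCoeffs_cf, ofCoeffs_cf]; simp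

theorem constCoeff_eq {x : SK} {c : ℕ →₀ k} (h : (x : AddMonoid.End (Kb k)) = oc c) :
    constCoeff p m Fq k hFq x = c 0 := by
  rw [← addPoly_eq_of_ofCoeffs_eq p m Fq k hFq ((ofCoeffs_cf p m Fq k hFq x).trans h)]
  rfl

end Skew

section Skew

variable (p m : ℕ) [Fact p.Prime] (Fq k : Type) [Field Fq] [Fintype Fq]
  [Field k] [Fintype k] [CharP k p] (hFq : Fintype.card Fq = p ^ m)

local notation "q" => Fintype.card Fq
local notation "τ" => tau p m Fq k hFq
local notation "SK" => skewPoly p m Fq k hFq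
local notation "oc" => ofCoeffs p m Fq k hFq

/-- Right division: if the kernel of `oc b` contains enough elements of that of `oc c`,
then `oc b` is a left multiple of `oc c`. -/
theorem exists_eq_mul_of_kills {c : ℕ →₀ k} {d : ℕ} (hd : c d ≠ 0) (hd' : ∀ i, d < i → c i = 0)
    (G : Finset (Kb k)) (hG : q ^ d ≤ G.card) (hc : ∀ w ∈ G, oc c w = 0) (N : ℕ) :
    ∀ b : ℕ →₀ k, (∀ i, N ≤ i → b i = 0) → (∀ w ∈ G, oc b w = 0) → ∃ a, oc b = oc a * oc c := by
  induction N with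
  | zero =>
    intro b hb _
    have : b = 0 := by ext i; exact hb i (Nat.zero_le _)
    exact ⟨0, by simp [this, ofCoeffs_zero]⟩
  | succ M ih =>
    intro b hb hbG
    rcases lt_or_ge M d with hM | hM
    · have h0 : addPoly q (liftCoeffs k b) = 0 := by
        refine eq_zero_of_natDegree_lt_card_of_eval_eq_zero' _ G (fun w hw => ?_) ?_
        · rw [← ofCoeffs_apply p m Fq k hFq, hbG w hw]
        · refine lt_of_lt_of_le (addPoly_natDegree_lt _ (one_lt_q Fq) (d := d) fun i hi => ?_) hG
          rw [liftCoeffs_apply, hb i (by omega), map_zero]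
      rw [addPoly_eq_zero_iff _ (one_lt_q Fq)] at h0
      have : b = 0 := liftCoeffs_injective k (h0.trans (by simp [liftCoeffs]))
      exact ⟨0, by simp [this, ofCoeffs_zero]⟩
    · set e : k := b M / c d ^ q ^ (M - d) with he
      have h1 : ∀ i, M ≤ i → (b - mulMon Fq k e (M - d) c) i = 0 := by
        intro i hi
        obtain ⟨i, rfl⟩ : ∃ j, i = j + (M - d) := ⟨i - (M - d), by omega⟩
        rw [Finsupp.sub_apply, mulMon_apply]
        rcases eq_or_lt_of_le hi with h | h
        · obtain rfl : i = d := by omega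
          rw [← h, he, div_mul_cancel₀ _ (pow_ne_zero _ hd), sub_self]
        · rw [hb _ h, hd' i (by omega), zero_pow (pow_ne_zero _ (one_lt_q Fq).ne_bot), mul_zero, sub_zero]
      have h2 : ∀ w ∈ G, oc (b - mulMon Fq k e (M - d) c) w = 0 := by
        intro w hw
        rw [ofCoeffs_sub, end_sub_apply, hbG w hw, ← mulMon_spec, end_mul_apply, hc w hw, map_zero,
          sub_zero]
      obtain ⟨a, ha⟩ := ih _ h1 h2
      refine ⟨a + Finsupp.single (M - d) e, ?_⟩
      rw [ofCoeffs_add, add_mul, ← ha, ofCoeffs_sub, ofCoeffs_single, mulMon_spec, sub_add_cancel]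

theorem exists_eq_mul_of_ker_le {v x : SK} (hv : constCoeff p m Fq k hFq v ≠ 0)
    (h : ∀ w : Kb k, v • w = 0 → x • w = 0) : ∃ y : SK, x = y * v := by
  classical
  have hv' := (ofCoeffs_cf p m Fq k hFq v).symm
  have hx' := (ofCoeffs_cf p m Fq k hFq x).symm
  set c := cf p m Fq k hFq v with hc
  set b := cf p m Fq k hFq x
  rw [constCoeff_eq p m Fq k hFq hv'] at hv
  obtain ⟨d, hd, hd'⟩ := exists_lead (a := c) (fun h0 => hv (by simp [h0]))
  have hdeg : (addPoly q (liftCoeffs k c)).natDegree = q ^ d :=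
    addPoly_natDegree_eq _ (one_lt_q Fq) (by simpa [liftCoeffs_apply] using hd)
      (fun i hi => by simp [liftCoeffs_apply, hd' i hi])
  have hsep : (addPoly q (liftCoeffs k c)).Separable := by
    rw [separable_def, addPoly_derivative _ (q_cast_eq_zero p m Fq k hFq), liftCoeffs_apply]
    have hv1 : algebraMap k (Kb k) (c 0) ≠ 0 := by simpa using hv
    exact ⟨0, C (algebraMap k (Kb k) (c 0))⁻¹, by rw [zero_mul, zero_add, ← C_mul, inv_mul_cancel₀ hv1, C_1]⟩
  obtain ⟨N, hN⟩ := exists_bound b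
  obtain ⟨a, ha⟩ := exists_eq_mul_of_kills p m Fq k hFq hd hd' (addPoly q (liftCoeffs k c)).roots.toFinset
    (by
      rw [Multiset.toFinset_card_of_nodup (nodup_roots hsep), ← hdeg]
      exact ((IsAlgClosed.splits _).natDegree_eq_card_roots).le)
    (fun w hw => by
      rw [ofCoeffs_apply]
      exact (mem_roots'.1 (Multiset.mem_toFinset.1 hw)).2) N b hN
    (fun w hw => by
      rw [← hx']
      refine h w ?_
      change (v : AddMonoid.End (Kb k)) w = 0
      rw [hv', ofCoeffs_apply]
      exact (mem_roots'.1 (Multiset.mem_toFinset.1 hw)).2)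
  exact ⟨⟨oc a, ofCoeffs_mem_skewPoly p m Fq k hFq a⟩, Subtype.ext (by
    rw [hx', ha]
    simp only [Subring.coe_mul, hv'])⟩

/-- The inclusion of the constants. -/
def mlHom : k →+* SK where
  toFun a := ⟨ml k a, ml_mem p m Fq k hFq a⟩
  map_one' := Subtype.ext (ml_one k)
  map_zero' := Subtype.ext (ml_zero k)
  map_add' a b := Subtype.ext (ml_add k a b)
  map_mul' a b := Subtype.ext (ml_mul k a b)

/-- The Frobenius as an element of the skew polynomial ring. -/
def tauS : SK := ⟨τ, tau_mem p m Fq k hFq⟩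

local notation "mS" => mlHom p m Fq k hFq
local notation "tS" => tauS p m Fq k hFq
local notation "κ" => constCoeff p m Fq k hFq

theorem constCoeff_mlHom (a : k) : κ (mS a) = a := by
  rw [constCoeff_eq p m Fq k hFq (c := Finsupp.single 0 a)]
  · simp
  · rw [ofCoeffs_single, pow_zero, mul_one]; rfl

theorem constCoeff_tauS : κ tS = 0 := by
  rw [constCoeff_eq p m Fq k hFq (c := Finsupp.single 1 1)]
  · simp
  · rw [ofCoeffs_single, ml_one, one_mul, pow_one]; rfl

theorem tauS_pow_mul_mlHom (i : ℕ) (a : k) : tS ^ i * mS a = mS (a ^ q ^ i) * tS ^ i :=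
  Subtype.ext (tau_pow_mul_ml p m Fq k hFq i a)

theorem eq_sum_cf (x : SK) : x = (cf p m Fq k hFq x).sum fun i a => mS a * tS ^ i := by
  apply Subtype.ext
  conv_lhs => rw [← ofCoeffs_cf p m Fq k hFq x, ofCoeffs, Finsupp.sum]
  rw [Finsupp.sum, AddSubmonoidClass.coe_finsetSum]
  rfl

theorem comm_of_comm {x : SK} (h1 : x * tS = tS * x) (h2 : ∀ a, x * mS a = mS a * x) (y : SK) :
    x * y = y * x := by
  rw [eq_sum_cf p m Fq k hFq y, Finsupp.sum, Finset.mul_sum, Finset.sum_mul]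
  refine Finset.sum_congr rfl fun i _ => ?_
  rw [← mul_assoc, h2, mul_assoc, mul_assoc, ((show Commute x tS from h1).pow_right i).eq]

theorem exists_eq_mul_tauS_pow {x : SK} (hx : x ≠ 0) : ∃ y j, x = y * tS ^ j ∧ κ y ≠ 0 := by
  have key : ∀ N : ℕ, ∀ x : SK, x ≠ 0 → (∃ i, i < N ∧ cf p m Fq k hFq x i ≠ 0) →
      ∃ y j, x = y * tS ^ j ∧ κ y ≠ 0 := by
    intro N
    induction N with
    | zero => rintro x - ⟨i, hi, -⟩; omega
    | succ N ih =>
      rintro x hx ⟨i, hi, hi0⟩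
      by_cases h0 : κ x = 0
      · set c := cf p m Fq k hFq x with hc
        have hc0 : c 0 = 0 := h0
        have hxc : c = Finsupp.mapDomain (· + 1) (c.comapDomain (· + 1) (add_left_injective 1).injOn) := by
          rw [Finsupp.mapDomain_comapDomain _ (add_left_injective 1)]
          intro j hj
          rcases j with _ | j
          · exact absurd hc0 (Finsupp.mem_support_iff.1 hj)
          · exact ⟨j, rfl⟩
        set b := c.comapDomain (· + 1) (add_left_injective 1).injOn with hb
        let z : SK := ⟨oc b, ofCoeffs_mem_skewPoly p m Fq k hFq b⟩
        have hz : x = z * tS := by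
          apply Subtype.ext
          rw [← ofCoeffs_cf p m Fq k hFq x, ← hc, hxc, ← ofCoeffs_mul_tau_pow, pow_one]
          rfl
        have hzb : cf p m Fq k hFq z = b := addPoly_eq_of_ofCoeffs_eq p m Fq k hFq (ofCoeffs_cf p m Fq k hFq z)
        obtain ⟨y, j, hy, hy0⟩ := ih z (by rintro h; exact hx (by rw [hz, h, zero_mul])) (by
          rcases i with _ | i
          · exact absurd hc0 hi0
          · exact ⟨i, by omega, by rwa [hzb]⟩)
        exact ⟨y, j + 1, by rw [hz, hy, pow_succ, mul_assoc], hy0⟩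
      · exact ⟨x, 0, by simp, h0⟩
  have hc : cf p m Fq k hFq x ≠ 0 := by
    intro h
    apply hx
    apply Subtype.ext
    rw [← ofCoeffs_cf p m Fq k hFq x, h, ofCoeffs_zero]
    rfl
  obtain ⟨d, hd, -⟩ := exists_lead hc
  exact key (d + 1) x hx ⟨d, by omega, hd⟩

theorem tauS_pow_mul (a : ℕ) (y : SK) : ∃ y', tS ^ a * y = y' * tS ^ a ∧ (κ y ≠ 0 → κ y' ≠ 0) := by
  refine ⟨(cf p m Fq k hFq y).sum fun i b => mS (b ^ q ^ a) * tS ^ i, ?_, fun h => ?_⟩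
  · conv_lhs => rw [eq_sum_cf p m Fq k hFq y]
    rw [Finsupp.sum, Finsupp.sum, Finset.mul_sum, Finset.sum_mul]
    refine Finset.sum_congr rfl fun i _ => ?_
    rw [← mul_assoc, tauS_pow_mul_mlHom, mul_assoc, mul_assoc, ← pow_add, ← pow_add, add_comm]
  · rw [Finsupp.sum, map_sum]
    have h0 : cf p m Fq k hFq y 0 ≠ 0 := h
    rw [Finset.sum_eq_single 0]
    · rw [map_mul, constCoeff_mlHom]
      simpa using h0
    · intro i _ hi
      rw [map_mul, map_pow (constCoeff p m Fq k hFq) (tauS p m Fq k hFq), constCoeff_tauS, zero_pow hi, mul_zero]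
    · intro h
      exact absurd (Finsupp.notMem_support_iff.1 h) h0

section Alg

variable (n : ℕ) (hk : Fintype.card k = Fintype.card Fq ^ n) (γ : Fq[X] →+* k)

theorem frobenius_comm (hk : Fintype.card k = Fintype.card Fq ^ n) (y : SK) : tS ^ n * y = y * tS ^ n := by
  refine comm_of_comm p m Fq k hFq ?_ (fun a => ?_) y
  · rw [← pow_succ, ← pow_succ']
  · rw [tauS_pow_mul_mlHom, ← hk, FiniteField.pow_card]

theorem const_comm (a : Fq) (y : SK) : mS (γ (C a)) * y = y * mS (γ (C a)) := by
  refine comm_of_comm p m Fq k hFq ?_ (fun b => ?_) y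
  · have := tauS_pow_mul_mlHom p m Fq k hFq 1 (γ (C a))
    rw [pow_one, pow_one, ← map_pow, ← C_pow, FiniteField.pow_card] at this
    exact this.symm
  · rw [← map_mul, ← map_mul, mul_comm]

/-- The map `𝔽_q[X] → k{τ}` with `X ↦ π = τ^n`. -/
def frobHom : Fq[X] →+* SK :=
  eval₂RingHom' ((mS).comp (γ.comp C)) (tS ^ n) fun a =>
    (const_comm p m Fq k hFq γ a (tS ^ n))

theorem frobHom_X : frobHom p m Fq k hFq n γ X = tS ^ n := eval₂_X _ _

theorem frobHom_C (a : Fq) : frobHom p m Fq k hFq n γ (C a) = mS (γ (C a)) := eval₂_C _ _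

/-- `k{τ}` as an algebra over `𝔽_q[π]`. -/
abbrev skewAlgebra : Algebra Fq[X] SK :=
  (frobHom p m Fq k hFq n γ).toAlgebra' fun c y => by
    induction c using Polynomial.induction_on' with
    | add a b ha hb => rw [map_add, add_mul, mul_add, ha, hb]
    | monomial i a =>
      rw [← C_mul_X_pow_eq_monomial, map_mul, map_pow, frobHom_X, frobHom_C]
      exact ((show Commute _ y from const_comm p m Fq k hFq γ a y).mul_left
        ((show Commute (tS ^ n) y from frobenius_comm p m Fq k hFq n hk y).pow_left i)).eq

theorem constCoeff_frobHom (hn : n ≠ 0) (c : Fq[X]) :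
    κ (frobHom p m Fq k hFq n γ c) = γ (C (c.coeff 0)) := by
  induction c using Polynomial.induction_on' with
  | add a b ha hb => rw [map_add, map_add, ha, hb, coeff_add, C_add, map_add]
  | monomial i a =>
    rw [← C_mul_X_pow_eq_monomial, map_mul, map_pow, frobHom_X, frobHom_C, map_mul, constCoeff_mlHom,
      map_pow, map_pow, constCoeff_tauS, zero_pow hn]
    rcases i with _ | i <;> simp

theorem skew_finite (hn : n ≠ 0) :
    letI := skewAlgebra p m Fq k hFq n hk γ
    Module.Finite Fq[X] SK := by
  let := skewAlgebra p m Fq k hFq n hk γ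
  refine ⟨Submodule.fg_def.2 ⟨Set.range fun x : k × Fin n => mS x.1 * tS ^ (x.2 : ℕ), Set.finite_range _, ?_⟩⟩
  rw [eq_top_iff]
  rintro x -
  rw [eq_sum_cf p m Fq k hFq x]
  refine Submodule.sum_mem _ fun i _ => ?_
  have : mS (cf p m Fq k hFq x i) * tS ^ i =
      (X ^ (i / n) : Fq[X]) • (mS (cf p m Fq k hFq x i) * tS ^ (i % n)) := by
    rw [Algebra.smul_def, Algebra.commutes, RingHom.algebraMap_toAlgebra', map_pow, frobHom_X, mul_assoc,
      ← pow_mul, ← pow_add, Nat.mod_add_div]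
  simp only [this]
  exact Submodule.smul_mem _ _ (Submodule.subset_span
    ⟨(_, ⟨i % n, Nat.mod_lt _ (Nat.pos_of_ne_zero hn)⟩), rfl⟩)

end Alg

end Skew

section AddPolyEval

variable {L : Type} [Field L] {q : ℕ}

theorem addPoly_eval (a : ℕ →₀ L) {N : ℕ} (h : ∀ i, N ≤ i → a i = 0) (w : L) :
    (addPoly q a).eval w = ∑ i ∈ Finset.range N, a i * w ^ q ^ i := by
  rw [addPoly, Finsupp.sum_of_support_subset a (s := Finset.range N), eval_finsetSum]
  · simp only [eval_monomial]
  · intro i hi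
    rw [Finset.mem_range]
    by_contra hlt
    exact Finsupp.mem_support_iff.1 hi (h i (not_lt.1 hlt))
  · simp

end AddPolyEval

section Skew

variable (p m : ℕ) [Fact p.Prime] (Fq k : Type) [Field Fq] [Fintype Fq]
  [Field k] [Fintype k] [CharP k p] (hFq : Fintype.card Fq = p ^ m)

local notation "q" => Fintype.card Fq
local notation "τ" => tau p m Fq k hFq
local notation "SK" => skewPoly p m Fq k hFq
local notation "oc" => ofCoeffs p m Fq k hFq
local notation "mS" => mlHom p m Fq k hFq
local notation "tS" => tauS p m Fq k hFq
local notation "κ" => constCoeff p m Fq k hFq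

theorem mem_range_of_pow_card {x : Kb k} (hx : x ^ Fintype.card k = x) :
    ∃ y : k, algebraMap k (Kb k) y = x := by
  classical
  by_contra! hne
  have h1 : (1 : ℕ) < Fintype.card k := Fintype.one_lt_card
  have h0 : (X ^ Fintype.card k - X : (Kb k)[X]) = 0 := by
    refine eq_zero_of_natDegree_lt_card_of_eval_eq_zero' _
      (insert x (Finset.univ.image (algebraMap k (Kb k)))) (fun w hw => ?_) ?_
    · rcases Finset.mem_insert.1 hw with rfl | hw
      · simp [hx]
      · obtain ⟨y, -, rfl⟩ := Finset.mem_image.1 hw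
        simp [← map_pow, FiniteField.pow_card]
    · rw [FiniteField.X_pow_card_sub_X_natDegree_eq _ h1, Finset.card_insert_of_notMem,
        Finset.card_image_of_injective _ (algebraMap k (Kb k)).injective, Finset.card_univ]
      · exact Nat.lt_succ_self _
      · simpa using hne
  exact FiniteField.X_pow_card_sub_X_ne_zero (Kb k) h1 h0

theorem exists_kernel (n : ℕ) (hk : Fintype.card k = Fintype.card Fq ^ n) (γ : Fq[X] →+* k)
    (hn : n ≠ 0) (G : AddSubgroup (Kb k))
    (hG : ∀ c : Fq[X], ∀ w ∈ G, frobHom p m Fq k hFq n γ c • w ∈ G) (c₀ : Fq[X])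
    (h0 : c₀.coeff 0 ≠ 0) (hkill : ∀ w ∈ G, frobHom p m Fq k hFq n γ c₀ • w = 0) :
    ∃ v : SK, κ v ≠ 0 ∧ ∀ w : Kb k, v • w = 0 ↔ w ∈ G := by
  classical
  have hq1 := one_lt_q Fq
  have hκ : κ (frobHom p m Fq k hFq n γ c₀) ≠ 0 := by
    rw [constCoeff_frobHom p m Fq k hFq n γ hn]
    exact fun h => h0 ((map_eq_zero (γ.comp C)).1 h)
  set x := frobHom p m Fq k hFq n γ c₀ with hx
  set c := cf p m Fq k hFq x with hc
  have hxc : (x : AddMonoid.End (Kb k)) = oc c := (ofCoeffs_cf p m Fq k hFq x).symm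
  have hP0 : addPoly q (liftCoeffs k c) ≠ 0 := by
    rw [Ne, addPoly_eq_zero_iff _ hq1]
    intro h
    have h' : liftCoeffs k c 0 = 0 := by rw [h]; rfl
    rw [liftCoeffs_apply] at h'
    exact hκ ((map_eq_zero _).1 h')
  have hkill' : ∀ w ∈ G, oc c w = 0 := fun w hw => by rw [← hxc]; exact hkill w hw
  have hfin : (G : Set (Kb k)).Finite := by
    refine (addPoly q (liftCoeffs k c)).roots.toFinset.finite_toSet.subset fun w hw => ?_
    simp only [Finset.mem_coe, Multiset.mem_toFinset, mem_roots hP0, IsRoot.def]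
    rw [← ofCoeffs_apply p m Fq k hFq, hkill' w hw]
  let alg : Algebra Fq (Kb k) := ((algebraMap k (Kb k)).comp (γ.comp C)).toAlgebra
  have hsm : ∀ (s : Fq) (w : Kb k), s • w = algebraMap k (Kb k) (γ (C s)) * w := fun s w => rfl
  let V : Submodule Fq (Kb k) :=
    { G with
      smul_mem' := fun s w hw => by
        have := hG (C s) w hw
        rw [frobHom_C] at this
        exact this }
  have : Finite V := hfin
  set d := Module.finrank Fq V with hd
  have hcard : hfin.toFinset.card = q ^ d := by
    rw [← Set.ncard_eq_toFinset_card _ hfin]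
    have := Module.natCard_eq_pow_finrank (K := Fq) (V := V)
    rwa [Nat.card_eq_fintype_card (α := Fq)] at this
  -- a nonzero `q`-polynomial of degree at most `q ^ d` vanishing on `G`
  let b : Module.Basis (Fin d) Fq V := Module.finBasis Fq V
  let M : Matrix (Fin d) (Fin (d + 1)) (Kb k) := fun j i => (b j : Kb k) ^ q ^ (i : ℕ)
  obtain ⟨a, haM, ha0⟩ := Submodule.exists_mem_ne_zero_of_ne_bot
    (LinearMap.ker_ne_bot_of_finrank_lt (f := M.mulVecLin) (by simp))
  let a' : ℕ →₀ Kb k := Finsupp.onFinset (Finset.range (d + 1))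
    (fun i => if h : i < d + 1 then a ⟨i, h⟩ else 0) (fun i hi => by
      by_contra h
      rw [Finset.mem_range] at h
      simp [h] at hi)
  have ha'v : ∀ i : Fin (d + 1), a' (i : ℕ) = a i := fun i => by
    simp only [a', Finsupp.onFinset_apply]
    rw [dif_pos i.2]
  have ha'b : ∀ i, d < i → a' i = 0 := fun i hi => by
    simp only [a', Finsupp.onFinset_apply]
    rw [dif_neg (by omega)]
  have ha'0 : a' ≠ 0 := by
    intro h
    apply ha0
    ext i
    rw [← ha'v, h]
    rfl
  have van : ∀ w ∈ G, (addPoly q a').eval w = 0 := by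
    let Λ : Kb k →ₗ[Fq] Kb k :=
      { toFun := fun w => ∑ i ∈ Finset.range (d + 1), a' i * w ^ q ^ i
        map_add' := fun v w => by
          rw [← Finset.sum_add_distrib]
          refine Finset.sum_congr rfl fun i _ => ?_
          rw [← mul_add, ← tau_pow_apply p m Fq k hFq, map_add, tau_pow_apply, tau_pow_apply]
        map_smul' := fun s w => by
          rw [RingHom.id_apply, Finset.smul_sum]
          refine Finset.sum_congr rfl fun i _ => ?_
          rw [hsm, hsm, mul_pow, ← map_pow, ← map_pow, ← C_pow, FiniteField.pow_card_pow]
          ring }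
    have hΛ : Λ.comp V.subtype = 0 := by
      refine b.ext fun j => ?_
      have := congrFun (LinearMap.mem_ker.1 haM) j
      rw [Matrix.mulVecLin_apply, Matrix.mulVec, dotProduct] at this
      change ∑ i ∈ Finset.range (d + 1), a' i * (b j : Kb k) ^ q ^ i = 0
      rw [Finset.sum_range]
      rw [Pi.zero_apply] at this
      rw [← this]
      exact Finset.sum_congr rfl fun i _ => by rw [ha'v, mul_comm]
    intro w hw
    rw [addPoly_eval a' (N := d + 1) fun i hi => ha'b i hi]
    exact LinearMap.congr_fun hΛ ⟨w, hw⟩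
  have small : ∀ e : ℕ →₀ Kb k, (∀ i, d ≤ i → e i = 0) → (∀ w ∈ G, (addPoly q e).eval w = 0) → e = 0 := by
    intro e he hv
    rw [← addPoly_eq_zero_iff _ hq1]
    refine eq_zero_of_natDegree_lt_card_of_eval_eq_zero' _ hfin.toFinset (fun w hw => ?_) ?_
    · exact hv w (by simpa using hw)
    · rw [hcard]
      exact addPoly_natDegree_lt _ hq1 he
  have had : a' d ≠ 0 := by
    intro h
    refine ha'0 (small a' (fun i hi => ?_) van)
    rcases eq_or_lt_of_le hi with rfl | hi
    · exact h
    · exact ha'b i hi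
  have vanr : ∀ w ∈ G, ∑ i ∈ Finset.range (d + 1), a' i * w ^ q ^ i = 0 := fun w hw => by
    rw [← addPoly_eval a' (N := d + 1) fun i hi => ha'b i hi, van w hw]
  -- the Frobenius of `k` permutes `G`, so the normalized coefficients are in `k`
  have hsurj : ∀ w ∈ G, ∃ v ∈ G, v ^ Fintype.card k = w := by
    have hpi : ∀ w ∈ G, w ^ Fintype.card k ∈ G := fun w hw => by
      have := hG X w hw
      rw [frobHom_X] at this
      have h2 : (tS ^ n) • w = (τ ^ n) w := rfl
      rwa [h2, tau_pow_apply, ← hk] at this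
    let f : G → G := fun w => ⟨(w : Kb k) ^ Fintype.card k, hpi w w.2⟩
    have hf : Function.Injective f := by
      intro v w hvw
      have h1 : (v : Kb k) ^ Fintype.card k = (w : Kb k) ^ Fintype.card k := congrArg Subtype.val hvw
      rw [hk, ← tau_pow_apply p m Fq k hFq, ← tau_pow_apply p m Fq k hFq, ← sub_eq_zero, ← map_sub,
        tau_pow_apply] at h1
      exact Subtype.ext (sub_eq_zero.1 (pow_eq_zero_iff (pow_ne_zero _ hq1.ne_bot) |>.1 h1))
    have : Finite G := hfin
    intro w hw
    obtain ⟨v, hv⟩ := Finite.surjective_of_injective hf ⟨w, hw⟩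
    exact ⟨v, v.2, congrArg Subtype.val hv⟩
  have hfix : ∀ i, (a' i / a' d) ^ Fintype.card k = a' i / a' d := by
    let e : ℕ →₀ Kb k := a'.mapRange (fun x => (x / a' d) ^ Fintype.card k - x / a' d)
      (by rw [zero_div, zero_pow Fintype.card_ne_zero, sub_zero])
    have he : e = 0 := by
      refine small e (fun i hi => ?_) fun w hw => ?_
      · rw [Finsupp.mapRange_apply]
        rcases eq_or_lt_of_le hi with rfl | hi
        · rw [div_self had, one_pow, sub_self]
        · rw [ha'b i hi, zero_div, zero_pow Fintype.card_ne_zero, sub_zero]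
      · rw [addPoly_eval e (N := d + 1) fun i hi => by
          rw [Finsupp.mapRange_apply, ha'b i hi, zero_div, zero_pow Fintype.card_ne_zero, sub_zero]]
        obtain ⟨v, hv, rfl⟩ := hsurj w hw
        simp only [e, Finsupp.mapRange_apply, sub_mul, Finset.sum_sub_distrib]
        have h1 : ∑ i ∈ Finset.range (d + 1), a' i / a' d * (v ^ Fintype.card k) ^ q ^ i = 0 := by
          have := congrArg (fun z => (a' d)⁻¹ * z) (vanr _ hw)
          simp only [Finset.mul_sum, mul_zero] at this
          rw [← this]
          exact Finset.sum_congr rfl fun i _ => by ring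
        have h2 : ∑ i ∈ Finset.range (d + 1), (a' i / a' d) ^ Fintype.card k * (v ^ Fintype.card k) ^ q ^ i = 0 := by
          have h3 : ∑ i ∈ Finset.range (d + 1), a' i / a' d * v ^ q ^ i = 0 := by
            have := congrArg (fun z => (a' d)⁻¹ * z) (vanr _ hv)
            simp only [Finset.mul_sum, mul_zero] at this
            rw [← this]
            exact Finset.sum_congr rfl fun i _ => by ring
          have h4 := congrArg (τ ^ n) h3
          rw [map_sum, map_zero] at h4
          rw [← h4]
          refine Finset.sum_congr rfl fun i _ => ?_
          rw [tau_pow_apply, ← hk]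
          ring
        rw [h1, h2, sub_zero]
    intro i
    have := DFunLike.congr_fun he i
    rw [Finsupp.mapRange_apply] at this
    exact sub_eq_zero.1 this
  choose g hg using fun i => mem_range_of_pow_card k (hfix i)
  let c' : ℕ →₀ k := Finsupp.onFinset (Finset.range (d + 1)) g (fun i hi => by
    by_contra h
    rw [Finset.mem_range] at h
    apply hi
    apply (algebraMap k (Kb k)).injective
    rw [hg, ha'b i (by omega), zero_div, map_zero])
  have hc'd : c' d = 1 := by
    apply (algebraMap k (Kb k)).injective
    rw [Finsupp.onFinset_apply, hg, div_self had, map_one]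
  have hc'b : ∀ i, d < i → c' i = 0 := fun i hi => by
    apply (algebraMap k (Kb k)).injective
    rw [Finsupp.onFinset_apply, hg, ha'b i hi, zero_div, map_zero]
  have hc'G : ∀ w ∈ G, oc c' w = 0 := by
    intro w hw
    rw [ofCoeffs_apply, addPoly_eval _ (N := d + 1) fun i hi => by
      rw [liftCoeffs_apply, hc'b i hi, map_zero]]
    have := congrArg (fun z => (a' d)⁻¹ * z) (vanr _ hw)
    simp only [Finset.mul_sum, mul_zero] at this
    rw [← this]
    refine Finset.sum_congr rfl fun i _ => ?_
    rw [liftCoeffs_apply, Finsupp.onFinset_apply, hg]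
    ring
  let v : SK := ⟨oc c', ofCoeffs_mem_skewPoly p m Fq k hFq c'⟩
  refine ⟨v, ?_, fun w => ⟨fun hw => ?_, fun hw => hc'G w hw⟩⟩
  · obtain ⟨N, hN⟩ := exists_bound c
    obtain ⟨y, hy⟩ := exists_eq_mul_of_kills p m Fq k hFq (c := c') (d := d) (by simp [hc'd]) hc'b
      hfin.toFinset hcard.ge (fun w hw => hc'G w (by simpa using hw)) N c hN
      (fun w hw => hkill' w (by simpa using hw))
    have hxy : x = (⟨oc y, ofCoeffs_mem_skewPoly p m Fq k hFq y⟩ : SK) * v := Subtype.ext (hxc.trans hy)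
    rw [hxy, map_mul] at hκ
    exact right_ne_zero_of_mul hκ
  · by_contra hwG
    have hlift : ∀ i, liftCoeffs k c' i = algebraMap k (Kb k) (c' i) := fun i => rfl
    have hz : addPoly q (liftCoeffs k c') = 0 := by
      refine eq_zero_of_natDegree_lt_card_of_eval_eq_zero' _ (insert w hfin.toFinset) (fun z hz => ?_) ?_
      · rw [← ofCoeffs_apply p m Fq k hFq]
        rcases Finset.mem_insert.1 hz with rfl | hz
        · exact hw
        · exact hc'G z (by simpa using hz)
      · rw [Finset.card_insert_of_notMem (by simpa using hwG), hcard,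
          addPoly_natDegree_eq _ hq1 (d := d) (by simp [hlift, hc'd]) (fun i hi => by simp [hlift, hc'b i hi])]
        exact Nat.lt_succ_self _
    rw [addPoly_eq_zero_iff _ hq1] at hz
    have := hlift d
    rw [hz, hc'd, map_one] at this
    exact one_ne_zero this.symm

end Skew

section FiniteClosure

theorem finite_of_semilinear {R R' M N : Type} [CommRing R] [CommRing R'] [IsNoetherianRing R]
    [AddCommGroup M] [Module R M] [AddCommGroup N] [Module R' N] [Module.Finite R' N]
    (σ : R →+* R') (hσ : σ.Finite) (f : M →+ N) (hf : Function.Injective f)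
    (hs : ∀ (r : R) (x : M), f (r • x) = σ r • f x) : Module.Finite R M := by
  let := σ.toAlgebra
  let : Module R N := Module.compHom N σ
  have : IsScalarTower R R' N := ⟨fun a b x => by
    rw [Algebra.smul_def, mul_smul]; rfl⟩
  have : Module.Finite R R' := hσ
  have : Module.Finite R N := Module.Finite.trans R' N
  let g : M →ₗ[R] N := { f with map_smul' := hs }
  have : IsNoetherian R M := isNoetherian_of_injective g hf
  exact Module.IsNoetherian.finite R M

theorem frobenius_polynomial_finite {F : Type} [Field F] [Finite F] (p n : ℕ) [ExpChar F p] :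
    (iterateFrobenius F[X] p n).Finite := by
  refine RingHom.IsIntegral.to_finite (fun x => ?_) ?_
  · refine ⟨X ^ p ^ n - C x, monic_X_pow_sub_C _ (pow_ne_zero _ (expChar_pos F p).ne'), ?_⟩
    simp [iterateFrobenius_def]
  · have h : ((iterateFrobenius F[X] p n).comp (algebraMap ℤ F[X])).FiniteType := by
      rw [RingHom.ext_int ((iterateFrobenius F[X] p n).comp (algebraMap ℤ F[X])) (algebraMap ℤ F[X]),
        RingHom.finiteType_algebraMap]
      have : Module.Finite ℤ F := inferInstance
      exact Algebra.FiniteType.trans (S := F) inferInstance inferInstance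
    exact h.of_comp_finiteType

theorem finite_integralClosure_polynomial {F K D : Type} [Field F] [Finite F] [Field K] [Field D]
    [Algebra F[X] K] [IsFractionRing F[X] K] [Algebra F[X] D] [Algebra K D] [IsScalarTower F[X] K D]
    [FiniteDimensional K D] : Module.Finite F[X] (integralClosure F[X] D) := by
  obtain ⟨p, hp⟩ := ExpChar.exists F
  have : ExpChar K p := expChar_of_injective_ringHom (f := (algebraMap F[X] K).comp C)
    ((IsFractionRing.injective F[X] K).comp C_injective) p
  let Ds := separableClosure K D
  have : IsScalarTower F[X] Ds D := ⟨fun a b c => smul_mul_assoc a (b : D) c⟩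
  let n := IsPurelyInseparable.exponent Ds D
  let it : D →+* Ds := IsPurelyInseparable.iterateFrobenius Ds D p (le_refl n)
  have hit : ∀ a, algebraMap Ds D (it a) = a ^ p ^ n := fun a =>
    IsPurelyInseparable.algebraMap_iterateFrobenius Ds p (le_refl n) a
  have h_integral : ∀ b : integralClosure F[X] D, it b ∈ integralClosure F[X] Ds := by
    intro b
    have : IsIntegral F[X] (algebraMap Ds D (it b)) := by
      rw [hit]; exact b.2.pow _
    exact (isIntegral_algebraMap_iff (algebraMap Ds D).injective).1 this
  have : Module.Finite F[X] (integralClosure F[X] Ds) := IsIntegralClosure.finite F[X] K Ds _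
  let f : integralClosure F[X] D →+ integralClosure F[X] Ds :=
    { toFun := fun b => ⟨it b, h_integral b⟩
      map_zero' := Subtype.ext (map_zero it)
      map_add' := fun a b => Subtype.ext (map_add it _ _) }
  refine finite_of_semilinear (iterateFrobenius F[X] p n) (frobenius_polynomial_finite p n) f ?_ ?_
  · intro a b h
    have := congrArg Subtype.val h
    exact Subtype.ext (it.injective this)
  · intro r x
    apply Subtype.ext
    apply (algebraMap Ds D).injective
    change algebraMap Ds D (it (r • (x : D))) = algebraMap Ds D ((iterateFrobenius F[X] p n r) • it x)
    rw [hit, Algebra.smul_def, Algebra.smul_def, map_mul, hit, mul_pow, iterateFrobenius_def, map_pow, map_pow,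
      ← IsScalarTower.algebraMap_apply]

end FiniteClosure

section Abstract

/-- The properties of the skew polynomial ring `S`, as an algebra over `F[π]` and acting on `W`,
that are used in the construction of isogenies. -/
structure SkewLike (F k S W : Type) [Field F] [Field k] [Ring S] [Algebra F[X] S]
    [AddCommGroup W] [Module S W] where
  κ : S →+* k
  κ_algebraMap : ∀ c : F[X], κ (algebraMap F[X] S c) = 0 ↔ c.coeff 0 = 0
  t : S
  n : ℕ
  t_pow : t ^ n = algebraMap F[X] S X
  t_ne_zero : t ≠ 0
  κ_t : κ t = 0
  pow_mul : ∀ (a : ℕ) (y : S), ∃ y', t ^ a * y = y' * t ^ a ∧ (κ y ≠ 0 → κ y' ≠ 0)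
  exists_eq_mul_pow : ∀ x : S, x ≠ 0 → ∃ y j, x = y * t ^ j ∧ κ y ≠ 0
  exists_eq_mul : ∀ v x : S, κ v ≠ 0 → (∀ w : W, v • w = 0 → x • w = 0) → ∃ y, x = y * v
  exists_kernel : ∀ G : AddSubgroup W, (∀ c : F[X], ∀ w ∈ G, algebraMap F[X] S c • w ∈ G) →
    (∃ c : F[X], c.coeff 0 ≠ 0 ∧ ∀ w ∈ G, algebraMap F[X] S c • w = 0) →
    ∃ v : S, κ v ≠ 0 ∧ ∀ w : W, v • w = 0 ↔ w ∈ G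

/-- `E` is the centralizer in `S` of a copy of `F[T]`. -/
structure CentSetup (F S E : Type) [Field F] [Ring S] [Algebra F[X] S] [CommRing E]
    [Algebra F[X] E] where
  ι : E →ₐ[F[X]] S
  inj : Function.Injective ι
  tE : F[X] →+* E
  cent : ∀ x : S, (∀ a, x * ι (tE a) = ι (tE a) * x) → ∃ e, ι e = x

theorem exists_eq_X_pow_mul {F : Type} [Field F] {h : F[X]} (hh : h ≠ 0) :
    ∃ s g, h = X ^ s * g ∧ g.coeff 0 ≠ 0 := by
  obtain ⟨g, hg, hd⟩ := exists_eq_pow_rootMultiplicity_mul_and_not_dvd h hh 0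
  rw [C_0, sub_zero] at hg hd
  exact ⟨_, g, hg, fun h0 => hd (X_dvd_iff.2 h0)⟩

variable {F k S W E D : Type} [Field F] [Field k] [Ring S] [IsDomain S] [Algebra F[X] S]
  [AddCommGroup W] [Module S W] [CommRing E] [Algebra F[X] E] [Field D] [Algebra E D]
  [Algebra F[X] D] [IsScalarTower F[X] E D] [IsFractionRing E D]

namespace SkewLike

variable (H : SkewLike F k S W)

include H in
theorem algebraMap_ne_zero {h : F[X]} (hh : h ≠ 0) : algebraMap F[X] S h ≠ 0 := by
  obtain ⟨s, g, rfl, hg⟩ := exists_eq_X_pow_mul hh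
  rw [map_mul, map_pow, ← H.t_pow]
  refine mul_ne_zero (pow_ne_zero _ (pow_ne_zero _ H.t_ne_zero)) fun h => hg ?_
  rw [← H.κ_algebraMap, h, map_zero]

include H in
theorem exists_dual [Module.Finite F[X] S] {u : S} (hu : u ≠ 0) :
    ∃ (û : S) (h : F[X]), h ≠ 0 ∧ u * û = algebraMap F[X] S h ∧ û * u = algebraMap F[X] S h := by
  have halg : IsAlgebraic F[X] u := (IsIntegral.of_finite F[X] u).isAlgebraic
  obtain ⟨h, hh, û, hû⟩ := halg.exists_nonzero_dvd (mem_nonZeroDivisors_of_ne_zero hu)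
  refine ⟨û, h, hh, hû.symm, ?_⟩
  apply mul_right_cancel₀ (b := û)
  · rintro rfl
    exact H.algebraMap_ne_zero hh (by rw [hû, mul_zero])
  · rw [mul_assoc, ← hû, Algebra.commutes]

/-- `x` is divisible by `t ^ a`. -/
def Fil (a : ℕ) (x : S) : Prop := ∃ y, x = y * H.t ^ a

variable {H}

theorem Fil.add {a : ℕ} {x y : S} (hx : H.Fil a x) (hy : H.Fil a y) : H.Fil a (x + y) := by
  obtain ⟨x', rfl⟩ := hx
  obtain ⟨y', rfl⟩ := hy
  exact ⟨x' + y', by rw [add_mul]⟩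

theorem Fil.neg {a : ℕ} {x : S} (hx : H.Fil a x) : H.Fil a (-x) := by
  obtain ⟨x', rfl⟩ := hx
  exact ⟨-x', by rw [neg_mul]⟩

theorem Fil.zero (a : ℕ) : H.Fil a 0 := ⟨0, by rw [zero_mul]⟩

theorem Fil.sum {ι : Type} {a : ℕ} (s : Finset ι) (f : ι → S) (hf : ∀ i ∈ s, H.Fil a (f i)) :
    H.Fil a (∑ i ∈ s, f i) := by
  classical
  induction s using Finset.induction_on with
  | empty => exact Fil.zero a
  | insert i s his ih =>
    rw [Finset.sum_insert his]
    exact (hf i (Finset.mem_insert_self _ _)).add (ih fun j hj => hf j (Finset.mem_insert_of_mem hj))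

theorem Fil.mul {a b : ℕ} {x y : S} (hx : H.Fil a x) (hy : H.Fil b y) : H.Fil (a + b) (x * y) := by
  obtain ⟨x', rfl⟩ := hx
  obtain ⟨y', rfl⟩ := hy
  obtain ⟨z, hz, -⟩ := H.pow_mul a y'
  exact ⟨x' * z, by rw [mul_assoc, ← mul_assoc (H.t ^ a), hz, pow_add]; simp only [mul_assoc]⟩

theorem Fil.mono {a b : ℕ} (hab : a ≤ b) {x : S} (hx : H.Fil b x) : H.Fil a x := by
  obtain ⟨x', rfl⟩ := hx
  exact ⟨x' * H.t ^ (b - a), by rw [mul_assoc, ← pow_add, Nat.sub_add_cancel hab]⟩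

theorem Fil.zero_left (x : S) : H.Fil 0 x := ⟨x, by simp⟩

theorem Fil.pow {a : ℕ} {x : S} (hx : H.Fil a x) (N : ℕ) : H.Fil (N * a) (x ^ N) := by
  induction N with
  | zero => simpa using Fil.zero_left (H := H) 1
  | succ N ih => rw [pow_succ, Nat.succ_mul]; exact ih.mul hx

theorem Fil.X_pow (s : ℕ) : H.Fil (H.n * s) (algebraMap F[X] S (X ^ s)) :=
  ⟨1, by rw [_root_.pow_mul, H.t_pow, one_mul, map_pow]⟩

theorem Fil.eq_mul_X_pow {s : ℕ} {x : S} (hx : H.Fil (H.n * s) x) :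
    ∃ y, x = y * algebraMap F[X] S (X ^ s) := by
  obtain ⟨y, rfl⟩ := hx
  exact ⟨y, by rw [_root_.pow_mul, H.t_pow, map_pow]⟩

theorem pow_eq (y : S) (hy : H.κ y ≠ 0) (j N : ℕ) :
    ∃ z, (y * H.t ^ j) ^ N = z * H.t ^ (N * j) ∧ H.κ z ≠ 0 := by
  induction N with
  | zero => exact ⟨1, by simp, by simp⟩
  | succ N ih =>
    obtain ⟨z, hz, hz0⟩ := ih
    obtain ⟨y', hy', hy0⟩ := H.pow_mul (N * j) y
    refine ⟨z * y', ?_, by rw [map_mul]; exact mul_ne_zero hz0 (hy0 hy)⟩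
    rw [pow_succ, hz, mul_assoc, ← mul_assoc (H.t ^ (N * j)), hy', Nat.succ_mul, pow_add]
    simp only [mul_assoc]

theorem not_fil {y : S} (hy : H.κ y ≠ 0) (j : ℕ) : ¬ H.Fil (j + 1) (y * H.t ^ j) := by
  rintro ⟨z, hz⟩
  rw [pow_succ', ← mul_assoc] at hz
  have := mul_right_cancel₀ (pow_ne_zero j H.t_ne_zero) hz
  rw [this, map_mul, H.κ_t, mul_zero] at hy
  exact hy rfl

/-- An element satisfying a suitable homogeneous equation lies in the expected filtration step. -/
theorem fil_of_equation {x : S} {a N : ℕ} (f : ℕ → S) (hf : ∀ i < N, H.Fil (a * (N - i)) (f i))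
    (h : x ^ N + ∑ i ∈ Finset.range N, f i * x ^ i = 0) : H.Fil a x := by
  by_cases hx : x = 0
  · rw [hx]; exact Fil.zero a
  obtain ⟨y, j, rfl, hy⟩ := H.exists_eq_mul_pow x hx
  by_contra hna
  have hj : j < a := by
    by_contra hj
    exact hna (Fil.mono (not_lt.1 hj) ⟨y, rfl⟩)
  obtain ⟨z, hz, hz0⟩ := pow_eq (H := H) y hy j N
  refine not_fil hz0 (N * j) ?_
  rw [← hz, eq_neg_of_add_eq_zero_left h]
  refine (Fil.sum _ _ fun i hi => ?_).neg
  have hi := Finset.mem_range.1 hi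
  refine Fil.mono ?_ ((hf i hi).mul (Fil.pow (H := H) ⟨y, rfl⟩ i))
  obtain ⟨l, rfl⟩ : ∃ l, N = i + l + 1 := ⟨N - i - 1, by omega⟩
  have : i + l + 1 - i = l + 1 := by omega
  rw [this]
  nlinarith [Nat.zero_le l, mul_le_mul (Nat.succ_le_of_lt hj) (le_refl (l + 1)) (Nat.zero_le _) (Nat.zero_le _)]

end SkewLike

namespace CentSetup

variable (Z : CentSetup F S E)

/-- `x ∈ S` represents `u d u⁻¹`. -/
def Rel (u : S) (d : D) (x : S) : Prop :=
  ∃ (e : E) (h : F[X]), h ≠ 0 ∧ d * algebraMap F[X] D h = algebraMap E D e ∧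
    x * u * algebraMap F[X] S h = u * Z.ι e

variable {Z} (H : SkewLike F k S W) {u : S} {d d' : D} {x x' : S}

theorem ι_algebraMap (c : F[X]) : Z.ι (algebraMap F[X] E c) = algebraMap F[X] S c := Z.ι.commutes c

theorem algebraMap_eq_iff {a b : E} : algebraMap E D a = algebraMap E D b ↔ a = b :=
  (IsFractionRing.injective E D).eq_iff

theorem algebraMap_poly (c : F[X]) : algebraMap F[X] D c = algebraMap E D (algebraMap F[X] E c) :=
  IsScalarTower.algebraMap_apply _ _ _ _

include H Z in
theorem algebraMapE_ne_zero {h : F[X]} (hh : h ≠ 0) : algebraMap F[X] E h ≠ 0 := fun h0 =>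
  H.algebraMap_ne_zero hh (by rw [← ι_algebraMap (Z := Z), h0, map_zero])

include H Z E in
theorem algebraMapD_ne_zero {h : F[X]} (hh : h ≠ 0) : algebraMap F[X] D h ≠ 0 := fun h0 =>
  algebraMapE_ne_zero (Z := Z) H hh (algebraMap_eq_iff (D := D).1 (by rw [← algebraMap_poly, h0, map_zero]))

include H in
theorem Rel.apply (h : Z.Rel u d x) {e₁ e₂ : E} (he : d * algebraMap E D e₂ = algebraMap E D e₁) :
    x * u * Z.ι e₂ = u * Z.ι e₁ := by
  obtain ⟨e, h, hh, h1, h2⟩ := h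
  apply mul_right_cancel₀ (H.algebraMap_ne_zero hh)
  have h3 : e * e₂ = e₁ * algebraMap F[X] E h := by
    apply algebraMap_eq_iff (D := D).1
    rw [map_mul, map_mul, ← h1, ← he, ← algebraMap_poly]; ring
  rw [mul_assoc, ← Algebra.commutes, ← mul_assoc, h2, mul_assoc, ← map_mul, h3, map_mul, ι_algebraMap,
    mul_assoc]

include H in
theorem Rel.unique (hu : u ≠ 0) (h : Z.Rel u d x) (h' : Z.Rel u d x') : x = x' := by
  obtain ⟨e, c, hc, h1, h2⟩ := h
  rw [algebraMap_poly (E := E)] at h1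
  have h3 := h'.apply H h1
  rw [ι_algebraMap, ← h2, mul_assoc, mul_assoc] at h3
  exact (mul_right_cancel₀ (mul_ne_zero hu (H.algebraMap_ne_zero hc)) h3).symm

include H in
theorem Rel.unique_left (hu : u ≠ 0) (h : Z.Rel u d x) (h' : Z.Rel u d' x) : d = d' := by
  obtain ⟨e, c, hc, h1, h2⟩ := h
  obtain ⟨e', c', hc', h1', h2'⟩ := h'
  have h3 : e * algebraMap F[X] E c' = e' * algebraMap F[X] E c := by
    apply Z.inj
    apply mul_left_cancel₀ hu
    rw [map_mul, map_mul, ← mul_assoc, ← h2, ← mul_assoc, ← h2', ι_algebraMap, ι_algebraMap, mul_assoc (x * u),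
      mul_assoc (x * u), ← map_mul, ← map_mul, mul_comm c c']
  have h4 := congrArg (algebraMap E D) h3
  rw [map_mul, map_mul, ← h1, ← h1', ← algebraMap_poly, ← algebraMap_poly] at h4
  have hne := mul_ne_zero (algebraMapD_ne_zero (Z := Z) (D := D) H hc) (algebraMapD_ne_zero (Z := Z) (D := D) H hc')
  exact mul_right_cancel₀ hne (by linear_combination h4)

theorem Rel.of_mem (e : E) (h : x * u = u * Z.ι e) : Z.Rel u (algebraMap E D e) x :=
  ⟨e, 1, one_ne_zero, by simp, by simp [h]⟩

theorem Rel.of_poly (c : F[X]) : Z.Rel u (algebraMap F[X] D c) (algebraMap F[X] S c) := by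
  rw [algebraMap_poly (E := E)]
  exact Rel.of_mem _ (by rw [ι_algebraMap, Algebra.commutes])

theorem Rel.add (h : Z.Rel u d x) (h' : Z.Rel u d' x') : Z.Rel u (d + d') (x + x') := by
  obtain ⟨e, c, hc, h1, h2⟩ := h
  obtain ⟨e', c', hc', h1', h2'⟩ := h'
  refine ⟨e * algebraMap F[X] E c' + e' * algebraMap F[X] E c, c * c', mul_ne_zero hc hc', ?_, ?_⟩
  · rw [map_add, map_mul, map_mul, map_mul, ← h1, ← h1', ← algebraMap_poly, ← algebraMap_poly]
    ring
  · rw [map_add, map_mul Z.ι, map_mul Z.ι, mul_add, ← mul_assoc, ← h2, ← mul_assoc, ← h2', ι_algebraMap, ι_algebraMap,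
      mul_assoc (x * u), ← map_mul, mul_assoc (x' * u), ← map_mul, mul_comm c' c, add_mul, add_mul]

theorem Rel.mul (h : Z.Rel u d x) (h' : Z.Rel u d' x') : Z.Rel u (d * d') (x * x') := by
  obtain ⟨e, c, hc, h1, h2⟩ := h
  obtain ⟨e', c', hc', h1', h2'⟩ := h'
  refine ⟨e * e', c * c', mul_ne_zero hc hc', ?_, ?_⟩
  · rw [map_mul, map_mul, ← h1, ← h1']
    ring
  · rw [map_mul Z.ι, ← mul_assoc u, ← h2, mul_comm c c', map_mul, ← mul_assoc, mul_assoc x x' u, mul_assoc x,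
      h2', mul_assoc (x * u), Algebra.commutes]
    simp only [mul_assoc]

theorem Rel.comp {v y : S} (h : Z.Rel u d y) (hx : x * v = v * y) : Z.Rel (v * u) d x := by
  obtain ⟨e, c, hc, h1, h2⟩ := h
  refine ⟨e, c, hc, h1, ?_⟩
  rw [← mul_assoc, hx, mul_assoc, mul_assoc, ← mul_assoc y, h2, mul_assoc]

theorem Rel.aeval (h : Z.Rel u d x) (P : F[X][X]) :
    Z.Rel u (Polynomial.aeval d P) (Polynomial.aeval x P) := by
  induction P using Polynomial.induction_on' with
  | add a b ha hb => rw [map_add, map_add]; exact ha.add hb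
  | monomial i a =>
    rw [aeval_monomial, aeval_monomial]
    refine (Rel.of_poly a).mul ?_
    induction i with
    | zero => rw [pow_zero, pow_zero]; simpa using Rel.of_poly (Z := Z) (u := u) (D := D) 1
    | succ i ih => rw [pow_succ, pow_succ]; exact ih.mul h

include H in
theorem Rel.isIntegral [Module.Finite F[X] S] (hu : u ≠ 0) (h : Z.Rel u d x) : IsIntegral F[X] d := by
  obtain ⟨P, hP, hPx⟩ := IsIntegral.of_finite F[X] x
  refine ⟨P, hP, ?_⟩
  have h1 := h.aeval P
  rw [aeval_def x, hPx] at h1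
  have h0 : Z.Rel u (0 : D) 0 := by simpa using Rel.of_poly (Z := Z) (u := u) (D := D) 0
  exact h1.unique_left H hu h0

include H in
/-- Elements commuting with the transported `F[T]` come from `D`. -/
theorem exists_rel [Module.Finite F[X] S] (hu : u ≠ 0) (xA : F[X] → S)
    (hxA : ∀ a, xA a * u = u * Z.ι (Z.tE a)) (hx : ∀ a, x * xA a = xA a * x) :
    ∃ d : D, IsIntegral F[X] d ∧ Z.Rel u d x := by
  obtain ⟨v, h, hh, h1, h2⟩ := H.exists_dual hu
  have hv : ∀ a, v * xA a = Z.ι (Z.tE a) * v := fun a => by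
    apply mul_right_cancel₀ hu
    rw [mul_assoc, hxA, ← mul_assoc, h2, mul_assoc, h2, Algebra.commutes]
  obtain ⟨e, he⟩ := Z.cent (v * x * u) fun a => by
    rw [mul_assoc, ← hxA, ← mul_assoc, mul_assoc v, hx, ← mul_assoc v, hv]
    simp only [mul_assoc]
  have hne := algebraMapD_ne_zero (Z := Z) (D := D) H hh
  have hR : Z.Rel u (algebraMap E D e / algebraMap F[X] D h) x := by
    refine ⟨e, h, hh, div_mul_cancel₀ _ hne, ?_⟩
    rw [he, mul_assoc v, ← mul_assoc u, h1, ← Algebra.commutes]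
  exact ⟨_, hR.isIntegral H hu, hR⟩

include H in
theorem exists_ringHom {R' : Type} [CommRing R'] (hu : u ≠ 0) (j : R' →+* D)
    (h : ∀ b, ∃ x, Z.Rel u (j b) x) : ∃ θ : R' →+* S, ∀ b, Z.Rel u (j b) (θ b) := by
  choose f hf using h
  refine ⟨{ toFun := f, map_one' := ?_, map_zero' := ?_, map_add' := ?_, map_mul' := ?_ }, hf⟩
  · refine (hf 1).unique H hu ?_
    simpa using Rel.of_poly (Z := Z) (u := u) (D := D) 1
  · intro a b
    refine (hf _).unique H hu ?_
    rw [map_mul]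
    exact (hf a).mul (hf b)
  · refine (hf 0).unique H hu ?_
    simpa using Rel.of_poly (Z := Z) (u := u) (D := D) 0
  · intro a b
    refine (hf _).unique H hu ?_
    rw [map_add]
    exact (hf a).add (hf b)

include H Z in
theorem finite_E [Module.Finite F[X] S] : Module.Finite F[X] E :=
  Module.Finite.of_injective Z.ι.toLinearMap Z.inj

include H Z in
theorem exists_denom [Module.Finite F[X] S] (d : D) :
    ∃ (e : E) (h : F[X]), h ≠ 0 ∧ d * algebraMap F[X] D h = algebraMap E D e := by
  have := finite_E (Z := Z) H
  obtain ⟨a, b, hb, rfl⟩ := IsFractionRing.div_surjective (A := E) d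
  obtain ⟨h, hh, c, hc⟩ := (IsIntegral.of_finite F[X] b).isAlgebraic.exists_nonzero_dvd hb
  refine ⟨a * c, h, hh, ?_⟩
  have : Nontrivial E := (algebraMap E D).domain_nontrivial
  have hb0 : algebraMap E D b ≠ 0 := IsFractionRing.to_map_ne_zero_of_mem_nonZeroDivisors hb
  rw [algebraMap_poly (E := E), hc, map_mul, map_mul, ← mul_assoc, div_mul_cancel₀ _ hb0]

include H Z in
/-- Every integral element of `D` is, up to a unit at `π`, in `E`. -/
theorem exists_mul_mem_E [Module.Finite F[X] S] {d : D} (hd : IsIntegral F[X] d) :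
    ∃ g : F[X], g.coeff 0 ≠ 0 ∧ ∃ e : E, d * algebraMap F[X] D g = algebraMap E D e := by
  obtain ⟨e, h, hh, hde⟩ := exists_denom (Z := Z) H d
  obtain ⟨s, g, rfl, hg⟩ := exists_eq_X_pow_mul hh
  refine ⟨g, hg, ?_⟩
  obtain ⟨P, hP, hPd⟩ := hd
  have hfil : H.Fil (H.n * s) (Z.ι e) := by
    refine SkewLike.fil_of_equation (N := P.natDegree)
      (fun i => Z.ι (algebraMap F[X] E (P.coeff i * (X ^ s * g) ^ (P.natDegree - i)))) (fun i hi => ?_) ?_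
    · rw [ι_algebraMap, mul_pow, ← mul_assoc, mul_comm _ (g ^ _), ← mul_assoc, map_mul, ← pow_mul]
      have := (SkewLike.Fil.zero_left (H := H) (algebraMap F[X] S (g ^ (P.natDegree - i) * P.coeff i))).mul
        (SkewLike.Fil.X_pow (H := H) (s * (P.natDegree - i)))
      rwa [zero_add, ← mul_assoc] at this
    · rw [← map_pow]
      simp only [← map_pow, ← map_mul, ← map_sum, ← map_add]
      rw [map_eq_zero_iff _ Z.inj]
      apply algebraMap_eq_iff (D := D).1
      rw [map_zero, map_add, map_pow, map_sum, ← hde]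
      rw [eval₂_eq_sum_range, Finset.sum_range_succ, hP.coeff_natDegree, map_one, one_mul] at hPd
      have := congrArg (fun z => z * algebraMap F[X] D (X ^ s * g) ^ P.natDegree) hPd
      simp only [zero_mul, add_mul, Finset.sum_mul] at this
      rw [← this, add_comm, ← mul_pow]
      congr 1
      refine Finset.sum_congr rfl fun i hi => ?_
      have hi := Finset.mem_range.1 hi
      rw [map_mul, map_pow, ← algebraMap_poly, map_mul, map_pow, ← hde, mul_pow,
        ← Nat.sub_add_cancel hi.le, pow_add, Nat.add_sub_cancel]
      ring
  obtain ⟨y, hy⟩ := hfil.eq_mul_X_pow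
  have hX : algebraMap F[X] S (X ^ s) ≠ 0 := H.algebraMap_ne_zero (pow_ne_zero _ X_ne_zero)
  obtain ⟨w, hw⟩ := Z.cent y fun a => by
    apply mul_right_cancel₀ hX
    rw [mul_assoc, ← Algebra.commutes, ← mul_assoc, ← hy, mul_assoc, ← hy, ← map_mul, ← map_mul, mul_comm]
  refine ⟨w, ?_⟩
  have hwe : w * algebraMap F[X] E (X ^ s) = e := Z.inj (by rw [map_mul, ι_algebraMap, hw, hy])
  apply mul_right_cancel₀ (algebraMapD_ne_zero (Z := Z) (D := D) H (pow_ne_zero s (X_ne_zero (R := F))))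
  rw [mul_assoc, ← map_mul, mul_comm g, hde, ← hwe, map_mul, ← algebraMap_poly]

include H Z in
/-- Endomorphism rings of isogenous modules are locally maximal at `π`. -/
theorem locally_maximal [Module.Finite F[X] S] (hu : u ≠ 0) (ψ : F[X] → S)
    (hψ : ∀ a, u * Z.ι (Z.tE a) = ψ a * u) (R : Subring D)
    (hR : ∀ x : S, (∀ a, x * ψ a = ψ a * x) → ∃ ρ ∈ R, Z.Rel u ρ x) {d : D} (hd : IsIntegral F[X] d) :
    ∃ g : F[X], g.coeff 0 ≠ 0 ∧ d * algebraMap F[X] D g ∈ R := by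
  obtain ⟨g', hg', y', hy'⟩ := exists_mul_mem_E (Z := Z) H hd
  obtain ⟨v, h, hh, h1, h2⟩ := H.exists_dual hu
  have hv : ∀ a, v * ψ a = Z.ι (Z.tE a) * v := fun a => by
    apply mul_right_cancel₀ hu
    rw [mul_assoc, ← hψ, ← mul_assoc, h2, mul_assoc, h2, Algebra.commutes]
  obtain ⟨s, g, rfl, hg⟩ := exists_eq_X_pow_mul hh
  have hX : algebraMap F[X] S (X ^ s) ≠ 0 := H.algebraMap_ne_zero (pow_ne_zero _ X_ne_zero)
  have hfil : H.Fil (H.n * s) (u * Z.ι y' * v) := by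
    have hv0 : v ≠ 0 := by rintro rfl; exact H.algebraMap_ne_zero hh (by rw [← h1, mul_zero])
    obtain ⟨u', i, hu', hu0⟩ := H.exists_eq_mul_pow u hu
    obtain ⟨v', j, hv', hv0'⟩ := H.exists_eq_mul_pow v hv0
    have hle : H.n * s ≤ i + j := by
      by_contra hlt
      obtain ⟨z, hz, hz0⟩ := H.pow_mul i v'
      have huv : u * v = (u' * z) * H.t ^ (i + j) := by
        rw [hu', hv', mul_assoc, ← mul_assoc (H.t ^ i), hz, pow_add]
        simp only [mul_assoc]
      refine SkewLike.not_fil (H := H) (y := u' * z) (by rw [map_mul]; exact mul_ne_zero hu0 (hz0 hv0')) (i + j) ?_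
      rw [← huv, h1, mul_comm, map_mul]
      have := (SkewLike.Fil.zero_left (H := H) (algebraMap F[X] S g)).mul (SkewLike.Fil.X_pow (H := H) s)
      exact this.mono (by omega)
    have hui : H.Fil i u := ⟨u', hu'⟩
    have hvj : H.Fil j v := ⟨v', hv'⟩
    have := (hui.mul (SkewLike.Fil.zero_left (H := H) (Z.ι y'))).mul hvj
    exact this.mono (by omega)
  obtain ⟨y, hy⟩ := hfil.eq_mul_X_pow
  obtain ⟨ρ, hρR, hρ⟩ := hR y fun a => by
    apply mul_right_cancel₀ hX
    rw [mul_assoc, ← Algebra.commutes, ← mul_assoc, ← hy, mul_assoc, hv, mul_assoc (ψ a), ← hy,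
      ← mul_assoc, mul_assoc u, ← map_mul, mul_comm, map_mul, ← mul_assoc, hψ]
    simp only [mul_assoc]
  have hyu : y * u = u * Z.ι (y' * algebraMap F[X] E g) := by
    apply mul_right_cancel₀ hX
    rw [mul_assoc, ← Algebra.commutes, ← mul_assoc, ← hy, mul_assoc, h2, mul_comm (X ^ s), map_mul, map_mul,
      ι_algebraMap]
    simp only [mul_assoc]
  have := hρ.unique_left H hu (Rel.of_mem (D := D) _ hyu)
  refine ⟨g' * g, by rw [mul_coeff_zero]; exact mul_ne_zero hg' hg, ?_⟩
  rw [map_mul, ← mul_assoc, hy', algebraMap_poly (E := E) g, ← map_mul, ← this]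
  exact hρR

end CentSetup

end Abstract

set_option maxHeartbeats 1000000 in
/-- If multiplication by `c` on the `c`-torsion of a module detects divisibility by `c`, then a
single torsion element does. -/
theorem exists_torsion_generator {B M : Type} [CommRing B] [IsDedekindDomain B] [AddCommGroup M]
    [Module B M] {c : B} (hc : c ≠ 0) (h : ∀ t : B, (∀ w : M, c • w = 0 → t • w = 0) → c ∣ t) :
    ∃ z : M, c • z = 0 ∧ ∀ t : B, t • z = 0 → c ∣ t := by
  classical
  have hc' : Ideal.span {c} ≠ (0 : Ideal B) := by simpa using hc
  have key : ∀ v : IsDedekindDomain.HeightOneSpectrum B, v.asIdeal ∣ Ideal.span {c} →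
      ∃ (b : Ideal B) (t : B) (w : M), Ideal.span {c} = v.asIdeal * b ∧ t ∈ b ∧ c • w = 0 ∧
        t • w ≠ 0 := by
    rintro v ⟨b, hb⟩
    have hb0 : b ≠ 0 := by
      rintro rfl
      exact hc' (by rw [hb, mul_zero])
    have hnot : ¬ b ≤ Ideal.span {c} := by
      intro hle
      have h1 : v.asIdeal * b = 1 * b := by
        rw [one_mul]
        exact le_antisymm Ideal.mul_le_right (hb ▸ hle)
      exact v.isPrime.ne_top (by simpa using mul_right_cancel₀ hb0 h1)
    obtain ⟨t, htb, ht⟩ := SetLike.not_le_iff_exists.1 hnot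
    rw [Ideal.mem_span_singleton] at ht
    have := mt (h t) ht
    push Not at this
    obtain ⟨w, hw, htw⟩ := this
    exact ⟨b, t, w, hb, htb, hw, htw⟩
  choose! b t w hb ht hw htw using key
  have hfin := Ideal.finite_factors hc'
  set s := hfin.toFinset with hs
  have hmem : ∀ v, v ∈ s ↔ v.asIdeal ∣ Ideal.span {c} := fun v => by simp [hs]
  have crt : ∀ v : IsDedekindDomain.HeightOneSpectrum B, ∃ y : B, ∀ v' ∈ s,
      y - (if v' = v then 1 else 0) ∈ v'.asIdeal := fun v => by
    obtain ⟨y, hy⟩ := IsDedekindDomain.exists_forall_sub_mem_ideal (s := s)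
      (fun v : IsDedekindDomain.HeightOneSpectrum B => v.asIdeal) (fun _ => 1)
      (fun v _ => v.prime) (fun v _ v' _ hne h => hne (IsDedekindDomain.HeightOneSpectrum.ext h))
      (fun v' => if v'.1 = v then 1 else 0)
    exact ⟨y, fun v' hv' => by simpa using hy v' hv'⟩
  choose ε hε using crt
  have hcz : c • (∑ v ∈ s, ε v • w v) = 0 := by
    rw [Finset.smul_sum]
    refine Finset.sum_eq_zero fun v hv => ?_
    rw [smul_comm, hw v ((hmem v).1 hv), smul_zero]
  refine ⟨_, hcz, ?_⟩
  by_contra hne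
  set z := ∑ v ∈ s, ε v • w v with hz
  set a : Ideal B := LinearMap.ker (LinearMap.toSpanSingleton B M z) with ha
  have hma : ∀ x, x ∈ a ↔ x • z = 0 := fun x => by simp [ha]
  have hca : Ideal.span {c} ≤ a := by
    rw [Ideal.span_singleton_le_iff_mem, hma, hcz]
  obtain ⟨d, hd⟩ := Ideal.dvd_iff_le.2 hca
  have hd1 : d ≠ ⊤ := by
    rintro rfl
    refine hne fun x hx => ?_
    rw [← Ideal.mem_span_singleton, hd, Ideal.mul_top]
    exact (hma x).2 hx
  obtain ⟨l, hl, hdl⟩ := Ideal.exists_le_maximal d hd1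
  obtain ⟨d', hd'⟩ := Ideal.dvd_iff_le.2 hdl
  have hcl : Ideal.span {c} = l * (a * d') := by rw [hd, hd']; ring
  have hl0 : l ≠ ⊥ := by
    rintro rfl
    exact hc' (by rw [hcl, Ideal.bot_mul]; rfl)
  let v : IsDedekindDomain.HeightOneSpectrum B := ⟨l, hl.isPrime, hl0⟩
  have hv : v.asIdeal ∣ Ideal.span {c} := ⟨_, hcl⟩
  have hbv : b v = a * d' := mul_left_cancel₀ (a := l) hl0 ((hb v hv).symm.trans hcl)
  have htz : t v • z = 0 := (hma _).1 (Ideal.mul_le_left (hbv ▸ ht v hv))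
  apply htw v hv
  rw [hz, Finset.smul_sum, Finset.sum_eq_single_of_mem v ((hmem v).2 hv)] at htz
  · have h1 := hε v v ((hmem v).2 hv)
    rw [if_pos rfl] at h1
    have h2 : (ε v - 1) * t v ∈ Ideal.span {c} := by
      rw [hb v hv]
      exact Ideal.mul_mem_mul h1 (ht v hv)
    obtain ⟨y, hy⟩ := Ideal.mem_span_singleton.1 h2
    have h3 : ((ε v - 1) * t v) • w v = 0 := by rw [hy, mul_comm, mul_smul, hw v hv, smul_zero]
    rw [sub_mul, one_mul, sub_smul, mul_comm, mul_smul, htz, zero_sub, neg_eq_zero] at h3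
    exact h3
  · intro v' hv' hvv
    have h1 := hε v' v ((hmem v).2 hv)
    rw [if_neg hvv.symm, sub_zero] at h1
    have h2 : ε v' * t v ∈ Ideal.span {c} := by
      rw [hb v hv]
      exact Ideal.mul_mem_mul h1 (ht v hv)
    obtain ⟨y, hy⟩ := Ideal.mem_span_singleton.1 h2
    rw [← mul_smul, mul_comm, hy, mul_comm, mul_smul, hw v' ((hmem v').1 hv'), smul_zero]

section Construct

theorem finite_and_isDedekindDomain {F D : Type} [Field F] [Finite F] [Field D] [Algebra F[X] D]
    (hinj : Function.Injective (algebraMap F[X] D)) (M : Submodule F[X] D) (hM : M.FG)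
    (h : ∀ d : D, ∃ c : F[X], c ≠ 0 ∧ d * algebraMap F[X] D c ∈ M) :
    Module.Finite F[X] (integralClosure F[X] D) ∧ IsDedekindDomain (integralClosure F[X] D) := by
  have : FaithfulSMul F[X] D := (faithfulSMul_iff_algebraMap_injective _ _).2 hinj
  let _ := FractionRing.liftAlgebra F[X] D
  have : IsScalarTower F[X] (FractionRing F[X]) D := FractionRing.isScalarTower_liftAlgebra F[X] D
  have : FiniteDimensional (FractionRing F[X]) D := by
    obtain ⟨s, hs⟩ := hM
    refine ⟨⟨s, eq_top_iff.2 fun d _ => ?_⟩⟩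
    obtain ⟨c, hc, hcd⟩ := h d
    have hle : M ≤ (Submodule.span (FractionRing F[X]) (s : Set D)).restrictScalars F[X] := by
      rw [← hs, Submodule.span_le]
      exact Submodule.subset_span
    have hne : algebraMap F[X] (FractionRing F[X]) c ≠ 0 := by
      rwa [Ne, map_eq_zero_iff _ (IsFractionRing.injective _ _)]
    have h1 : algebraMap F[X] (FractionRing F[X]) c • d ∈
        Submodule.span (FractionRing F[X]) (s : Set D) := by
      rw [Algebra.smul_def, ← IsScalarTower.algebraMap_apply, mul_comm]
      exact hle hcd
    rw [← inv_smul_smul₀ hne d]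
    exact Submodule.smul_mem _ _ h1
  have hfin : Module.Finite F[X] (integralClosure F[X] D) :=
    finite_integralClosure_polynomial (K := FractionRing F[X])
  refine ⟨hfin, ?_⟩
  have h1 : IsIntegrallyClosed (integralClosure F[X] D) :=
    integralClosure.isIntegrallyClosedOfFiniteExtension (FractionRing F[X])
  have h2 : IsNoetherianRing (integralClosure F[X] D) := IsNoetherianRing.of_finite F[X] _
  have h3 : Ring.DimensionLEOne (integralClosure F[X] D) := inferInstance
  exact { h2, h3, h1 with : IsDedekindDomain (integralClosure F[X] D) }

/-- A finite module which is locally at `X` contained in `N` is moved into `N` by a single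
polynomial prime to `X`. -/
theorem exists_uniform_mul_mem {F M : Type} [Field F] [AddCommGroup M] [Module F[X] M]
    {B : Submodule F[X] M} (hB : B.FG) (N : Submodule F[X] M)
    (h : ∀ b ∈ B, ∃ c : F[X], c.coeff 0 ≠ 0 ∧ c • b ∈ N) :
    ∃ c : F[X], c.coeff 0 ≠ 0 ∧ ∀ b ∈ B, c • b ∈ N := by
  classical
  induction B, hB using Submodule.fg_induction with
  | singleton x =>
    obtain ⟨c, hc, hcx⟩ := h x (Submodule.mem_span_singleton_self x)
    refine ⟨c, hc, fun b hb => ?_⟩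
    obtain ⟨a, rfl⟩ := Submodule.mem_span_singleton.1 hb
    rw [smul_comm]
    exact N.smul_mem a hcx
  | sup B₁ B₂ h₁ h₂ ih₁ ih₂ =>
    obtain ⟨c₁, hc₁, hb₁⟩ := ih₁ fun b hb => h b (Submodule.mem_sup_left hb)
    obtain ⟨c₂, hc₂, hb₂⟩ := ih₂ fun b hb => h b (Submodule.mem_sup_right hb)
    refine ⟨c₁ * c₂, by rw [mul_coeff_zero]; exact mul_ne_zero hc₁ hc₂, fun b hb => ?_⟩
    obtain ⟨x, hx, y, hy, rfl⟩ := Submodule.mem_sup.1 hb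
    rw [smul_add]
    refine N.add_mem ?_ ?_
    · rw [mul_comm, mul_smul]
      exact N.smul_mem _ (hb₁ x hx)
    · rw [mul_smul]
      exact N.smul_mem _ (hb₂ y hy)

variable {F k S W E D : Type} [Field F] [Field k] [Ring S] [IsDomain S] [Algebra F[X] S]
  [AddCommGroup W] [Module S W] [CommRing E] [Algebra F[X] E] [Field D] [Algebra E D]
  [Algebra F[X] D] [IsScalarTower F[X] E D] [IsFractionRing E D]

namespace CentSetup

variable {Z : CentSetup F S E} (H : SkewLike F k S W)

include H Z in
theorem integralClosure_properties [Finite F] [Module.Finite F[X] S] :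
    Module.Finite F[X] (integralClosure F[X] D) ∧ IsDedekindDomain (integralClosure F[X] D) := by
  have := finite_E (Z := Z) H
  refine finite_and_isDedekindDomain
    ((injective_iff_map_eq_zero _).2 fun c hc => by_contra fun h0 =>
      algebraMapD_ne_zero (Z := Z) (D := D) H h0 hc)
    (LinearMap.range (IsScalarTower.toAlgHom F[X] E D).toLinearMap)
    (by rw [LinearMap.range_eq_map]; exact (Module.Finite.fg_top).map _) fun d => ?_
  obtain ⟨e, c, hc, hd⟩ := exists_denom (Z := Z) H d
  exact ⟨c, hc, e, hd.symm⟩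

include H Z in
theorem exists_conductor [Finite F] [Module.Finite F[X] S] (R : Subring D)
    (hRP : ∀ c, algebraMap F[X] D c ∈ R)
    (hloc : ∀ d : D, IsIntegral F[X] d → ∃ g : F[X], g.coeff 0 ≠ 0 ∧ d * algebraMap F[X] D g ∈ R) :
    ∃ c : F[X], c.coeff 0 ≠ 0 ∧ ∀ d : D, IsIntegral F[X] d → algebraMap F[X] D c * d ∈ R ∧
      ∃ e : E, algebraMap E D e = algebraMap F[X] D c * d := by
  have hfin := (integralClosure_properties (D := D) (Z := Z) H).1
  have hfg : (Subalgebra.toSubmodule (integralClosure F[X] D)).FG := Module.Finite.iff_fg.1 hfin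
  let N : Submodule F[X] D :=
    { carrier := {d | d ∈ R ∧ ∃ e : E, algebraMap E D e = d}
      add_mem' := by
        rintro _ _ ⟨h1, e1, rfl⟩ ⟨h2, e2, rfl⟩
        exact ⟨R.add_mem h1 h2, e1 + e2, map_add _ _ _⟩
      zero_mem' := ⟨R.zero_mem, 0, map_zero _⟩
      smul_mem' := by
        rintro c _ ⟨h1, e1, rfl⟩
        rw [Algebra.smul_def]
        exact ⟨R.mul_mem (hRP c) h1, algebraMap F[X] E c * e1, by rw [map_mul, ← algebraMap_poly]⟩ }
  obtain ⟨c, hc, h⟩ := exists_uniform_mul_mem hfg N fun b hb => by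
    obtain ⟨g, hg, hgR⟩ := hloc b hb
    obtain ⟨g', hg', e, he⟩ := exists_mul_mem_E (Z := Z) H hb
    refine ⟨g * g', by rw [mul_coeff_zero]; exact mul_ne_zero hg hg', ?_, e * algebraMap F[X] E g, ?_⟩
    · rw [Algebra.smul_def, mul_comm, map_mul, ← mul_assoc]
      exact R.mul_mem hgR (hRP g')
    · rw [Algebra.smul_def, map_mul, map_mul, ← algebraMap_poly, ← he]
      ring
  refine ⟨c, hc, fun d hd => ?_⟩
  have := h d hd
  rw [Algebra.smul_def] at this
  exact this

include H in
/-- There is an isogeny to a module whose endomorphism ring is the maximal order. -/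
theorem exists_maximal {c : F[X]} (hc : c.coeff 0 ≠ 0) (hcE : ∀ d : D, IsIntegral F[X] d →
      ∃ e : E, algebraMap E D e = algebraMap F[X] D c * d) :
    ∃ u : S, H.κ u ≠ 0 ∧ ∃ θ : integralClosure F[X] D →+* S,
      ∀ b : integralClosure F[X] D, Z.Rel u (b : D) (θ b) := by
  have hcE' : ∀ b : integralClosure F[X] D, ∃ e : E, algebraMap E D e = algebraMap F[X] D c * b :=
    fun b => hcE b b.2
  have hc0 : c ≠ 0 := by rintro rfl; exact hc (coeff_zero 0)
  choose ec hec using hcE'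
  have hκc : H.κ (algebraMap F[X] S c) ≠ 0 := fun h0 => hc ((H.κ_algebraMap c).1 h0)
  have hone : ec 1 = algebraMap F[X] E c := by
    apply algebraMap_eq_iff (D := D).1
    rw [hec, ← algebraMap_poly]; simp
  have hmul : ∀ b b', ec b' * ec b = ec (b' * b) * algebraMap F[X] E c := fun b b' => by
    apply algebraMap_eq_iff (D := D).1
    rw [map_mul, map_mul, hec, hec, hec, ← algebraMap_poly]
    push_cast
    ring
  obtain ⟨u, hu, hker⟩ := H.exists_kernel
    { carrier := {w | ∀ b, Z.ι (ec b) • w = 0}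
      add_mem' := fun {w w'} h h' b => by rw [smul_add, h b, h' b, add_zero]
      zero_mem' := fun b => smul_zero _
      neg_mem' := fun {w} h b => by rw [smul_neg, h b, neg_zero] }
    (fun a w hw b => by rw [← mul_smul, ← Algebra.commutes, mul_smul, hw b, smul_zero])
    ⟨c, hc, fun w hw => by
      have := hw 1
      rwa [hone, ι_algebraMap] at this⟩
  have hu0 : u ≠ 0 := by rintro rfl; exact hu (map_zero _)
  refine ⟨u, hu, exists_ringHom H hu0 (integralClosure F[X] D).val.toRingHom fun b => ?_⟩
  obtain ⟨y, hy⟩ := H.exists_eq_mul (u * algebraMap F[X] S c) (u * Z.ι (ec b))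
    (by rw [map_mul]; exact mul_ne_zero hu hκc) fun w hw => by
      rw [mul_smul] at hw ⊢
      rw [hker] at hw ⊢
      intro b'
      rw [← mul_smul, ← map_mul, hmul, map_mul, ι_algebraMap, mul_smul]
      exact hw (b' * b)
  refine ⟨y, ec b, c, hc0, ?_, ?_⟩
  · rw [hec, mul_comm]
    rfl
  · rw [hy, mul_assoc]

include H in
/-- A locally maximal order is the endomorphism ring of an isogenous module. -/
theorem exists_order [Finite F] [Module.Finite F[X] S] (R : Subring D)
    (hRP : ∀ c, algebraMap F[X] D c ∈ R) (hRA : ∀ a, algebraMap E D (Z.tE a) ∈ R)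
    (h_integral : ∀ ρ ∈ R, IsIntegral F[X] ρ)
    (hloc : ∀ d : D, IsIntegral F[X] d → ∃ g : F[X], g.coeff 0 ≠ 0 ∧ d * algebraMap F[X] D g ∈ R) :
    ∃ u : S, H.κ u ≠ 0 ∧ ∃ θ : R →+* S, (∀ ρ : R, Z.Rel u (ρ : D) (θ ρ)) ∧
      ∀ x : S, (∀ a, x * θ ⟨_, hRA a⟩ = θ ⟨_, hRA a⟩ * x) → ∃ ρ ∈ R, Z.Rel u ρ x := by
  have hded := (integralClosure_properties (D := D) (Z := Z) H).2
  obtain ⟨c, hc, hcR⟩ := exists_conductor (Z := Z) H R hRP hloc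
  obtain ⟨u₀, hu₀, θ, hθ⟩ := exists_maximal (Z := Z) (D := D) H hc fun d hd => (hcR d hd).2
  have hne₀ : u₀ ≠ 0 := by rintro rfl; exact hu₀ (map_zero _)
  have hc0 : c ≠ 0 := by rintro rfl; exact hc (coeff_zero 0)
  have hκc : H.κ (algebraMap F[X] S c) ≠ 0 := fun h0 => hc ((H.κ_algebraMap c).1 h0)
  have hθc : ∀ a : F[X], θ (algebraMap F[X] _ a) = algebraMap F[X] S a := fun a =>
    (hθ _).unique H hne₀ (Rel.of_poly a)
  have hcomm : ∀ a b, θ a * θ b = θ b * θ a := fun a b => by rw [← map_mul, mul_comm, map_mul]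
  let _ : Module (integralClosure F[X] D) W := Module.compHom W θ
  have hsmul : ∀ (b : integralClosure F[X] D) (w : W), b • w = θ b • w := fun _ _ => rfl
  obtain ⟨z, hcz, hz⟩ := exists_torsion_generator (M := W)
    (c := algebraMap F[X] (integralClosure F[X] D) c)
    (fun h0 => H.algebraMap_ne_zero hc0 (by rw [← hθc, h0, map_zero])) fun t ht => by
      obtain ⟨s, hs⟩ := H.exists_eq_mul (algebraMap F[X] S c) (θ t) hκc fun w hw => by
        rw [← hθc, ← hsmul] at hw
        exact ht w hw
      let tB : F[X] → integralClosure F[X] D := fun a => ⟨algebraMap E D (Z.tE a), h_integral _ (hRA a)⟩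
      obtain ⟨d, hd, hds⟩ := exists_rel (D := D) (x := s) H hne₀ (fun a => θ (tB a))
        (fun a => by
          have := (hθ (tB a)).apply H (e₁ := Z.tE a) (e₂ := 1) (by rw [map_one, mul_one])
          rwa [map_one, mul_one] at this)
        (fun a => by
          apply mul_right_cancel₀ (H.algebraMap_ne_zero hc0)
          rw [mul_assoc, ← Algebra.commutes, ← mul_assoc, ← hs, mul_assoc (θ (tB a)), ← hs, hcomm])
      have h1 := hds.mul (Rel.of_poly (Z := Z) (u := u₀) (D := D) c)
      rw [← hs] at h1
      refine ⟨⟨d, hd⟩, Subtype.ext ?_⟩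
      rw [(hθ t).unique_left H hne₀ h1, mul_comm]
      rfl
  rw [hsmul, hθc] at hcz
  obtain ⟨u₁, hu₁, hker⟩ := H.exists_kernel
    { carrier := {w | ∃ b : integralClosure F[X] D, (b : D) ∈ R ∧ θ b • z = w}
      add_mem' := by
        rintro _ _ ⟨b, hb, rfl⟩ ⟨b', hb', rfl⟩
        exact ⟨b + b', R.add_mem hb hb', by rw [map_add, add_smul]⟩
      zero_mem' := ⟨0, R.zero_mem, by rw [map_zero, zero_smul]⟩
      neg_mem' := by
        rintro _ ⟨b, hb, rfl⟩
        exact ⟨-b, R.neg_mem hb, by rw [map_neg, neg_smul]⟩ }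
    (by
      rintro a _ ⟨b, hb, rfl⟩
      exact ⟨algebraMap F[X] _ a * b, R.mul_mem (hRP a) hb, by rw [map_mul, hθc, mul_smul]⟩)
    ⟨c, hc, by
      rintro _ ⟨b, hb, rfl⟩
      rw [← mul_smul, Algebra.commutes, mul_smul, hcz, smul_zero]⟩
  have hne₁ : u₁ ≠ 0 := by rintro rfl; exact hu₁ (map_zero _)
  have hne := mul_ne_zero hne₁ hne₀
  refine ⟨u₁ * u₀, by rw [map_mul]; exact mul_ne_zero hu₁ hu₀, ?_⟩
  obtain ⟨θR, hθR⟩ := exists_ringHom (Z := Z) H hne R.subtype fun ρ => by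
    obtain ⟨x, hx⟩ := H.exists_eq_mul u₁ (u₁ * θ ⟨ρ, h_integral ρ ρ.2⟩) hu₁ fun w hw => by
      obtain ⟨b, hb, rfl⟩ := (hker w).1 hw
      rw [mul_smul, hker]
      exact ⟨⟨ρ, h_integral ρ ρ.2⟩ * b, R.mul_mem ρ.2 hb, by rw [map_mul, mul_smul]⟩
    exact ⟨x, (hθ ⟨ρ, h_integral ρ ρ.2⟩).comp hx.symm⟩
  refine ⟨θR, hθR, fun x hx => ?_⟩
  obtain ⟨ρ, hρ, hρx⟩ := exists_rel (D := D) H hne (fun a => θR ⟨_, hRA a⟩)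
    (fun a => by
      have := (hθR ⟨_, hRA a⟩).apply H (e₁ := Z.tE a) (e₂ := 1) (by rw [map_one, mul_one]; rfl)
      rwa [map_one, mul_one] at this) hx
  refine ⟨ρ, ?_, hρx⟩
  let b : integralClosure F[X] D := ⟨ρ, hρ⟩
  have hxu : x * u₁ = u₁ * θ b := by
    obtain ⟨e, h, hh, h1, h2⟩ := hθ b
    rw [algebraMap_poly (E := E)] at h1
    have h3 := hρx.apply H h1
    rw [ι_algebraMap] at h3
    apply mul_right_cancel₀ (mul_ne_zero hne₀ (H.algebraMap_ne_zero hh))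
    rw [mul_assoc u₁, ← mul_assoc (θ b), h2, ← mul_assoc u₁, ← h3]
    simp only [mul_assoc]
  have hzker : u₁ • z = 0 := (hker z).2 ⟨1, R.one_mem, by rw [map_one, one_smul]⟩
  obtain ⟨r, hr, hrz⟩ := (hker (θ b • z)).1 (by rw [← mul_smul, ← hxu, mul_smul, hzker, smul_zero])
  obtain ⟨b', hb'⟩ := hz (b - r) (by rw [hsmul, map_sub, sub_smul, hrz, sub_self])
  have h4 : ρ = algebraMap F[X] D c * b' + r := by
    have := congrArg Subtype.val hb'
    exact sub_eq_iff_eq_add.1 this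
  rw [h4]
  exact R.add_mem (hcR _ b'.2).1 hr

end CentSetup

end Construct

section Integral

theorem isIntegralElem_trans {A B D : Type} [CommRing A] [CommRing B] [CommRing D] (f : A →+* D)
    (g : B →+* D) (h : ∀ a, g.IsIntegralElem (f a)) {d : D} (hd : f.IsIntegralElem d) :
    g.IsIntegralElem d := by
  let _ := g.toAlgebra
  let f' : A →+* integralClosure B D := f.codRestrict (integralClosure B D) h
  obtain ⟨P, hP, hPd⟩ := hd
  have h1 : IsIntegral (integralClosure B D) d :=
    ⟨P.map f', hP.map f', by rw [eval₂_map]; exact hPd⟩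
  exact isIntegral_trans (R := B) d h1

theorem isIntegralElem_iff {A D : Type} [CommRing A] [CommRing D] [Nontrivial D] (f : A →+* D)
    (d : D) : (∃ N : ℕ, 0 < N ∧ ∃ c : ℕ → A, d ^ N + ∑ i ∈ Finset.range N, f (c i) * d ^ i = 0) ↔
      f.IsIntegralElem d := by
  have : Nontrivial A := f.domain_nontrivial
  constructor
  · rintro ⟨N, -, c, h⟩
    refine ⟨X ^ N + ∑ i ∈ Finset.range N, C (c i) * X ^ i, monic_X_pow_add ?_, ?_⟩
    · refine (degree_sum_le _ _).trans_lt ((Finset.sup_lt_iff (WithBot.bot_lt_coe N)).2 fun i hi => ?_)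
      exact (degree_C_mul_X_pow_le i (c i)).trans_lt (WithBot.coe_lt_coe.2 (Finset.mem_range.1 hi))
    · rw [eval₂_add, eval₂_X_pow, eval₂_finsetSum]
      simpa only [eval₂_mul, eval₂_C, eval₂_X_pow] using h
  · rintro ⟨P, hP, h⟩
    refine ⟨P.natDegree, Nat.pos_of_ne_zero fun h0 => ?_, P.coeff, ?_⟩
    · rw [hP.natDegree_eq_zero.1 h0, eval₂_one] at h
      exact one_ne_zero h
    · rw [eval₂_eq_sum_range, Finset.sum_range_succ, hP.coeff_natDegree, map_one, one_mul] at h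
      rw [add_comm, h]

end Integral

section Concrete

variable (p m : ℕ) [Fact p.Prime] (Fq k : Type) [Field Fq] [Fintype Fq]
  [Field k] [Fintype k] [CharP k p] (hFq : Fintype.card Fq = p ^ m)
  {γ : Polynomial Fq →+* k} {r : ℕ}

local notation "SK" => skewPoly p m Fq k hFq

theorem toRingHom_C (φ : DrinfeldModule p m Fq k hFq γ r) (a : Fq) :
    φ.toRingHom (C a) = ml k (γ (C a)) := by
  rw [φ.eq_ofCoeffs, show φ.coeffs (C a) = Finsupp.single 0 (γ (C a)) from ?_, ofCoeffs_single,
    pow_zero, mul_one]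
  ext i
  rcases Nat.eq_zero_or_pos i with rfl | hi
  · rw [φ.coeff_zero, Finsupp.single_eq_same]
  · rw [φ.coeff_eq_zero _ _ (by rwa [natDegree_C, mul_zero]), Finsupp.single_eq_of_ne hi.ne']

theorem toRingHom_ne_zero (φ : DrinfeldModule p m Fq k hFq γ r) {a : Fq[X]} (ha : a ≠ 0) :
    φ.toRingHom a ≠ 0 := by
  rw [φ.eq_ofCoeffs, Ne, ofCoeffs_eq_zero_iff]
  intro h
  exact φ.coeff_top a ha (by rw [h]; rfl)

theorem toRingHom_mem (φ : DrinfeldModule p m Fq k hFq γ r) (a : Fq[X]) : φ.toRingHom a ∈ SK := by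
  rw [φ.eq_ofCoeffs]
  exact ofCoeffs_mem_skewPoly p m Fq k hFq _

/-- The target of a separable isogeny is a Drinfeld module. -/
theorem exists_drinfeldModule (φ : DrinfeldModule p m Fq k hFq γ r) {u : SK} (hu : constCoeff p m Fq k hFq u ≠ 0)
    (θ : Fq[X] →+* SK) (h : ∀ a, (θ a * u : AddMonoid.End (Kb k)) = u * φ.toRingHom a) :
    ∃ ψ : DrinfeldModule p m Fq k hFq γ r, ∀ a, ψ.toRingHom a = θ a := by
  have hq1 := one_lt_q Fq
  have hcu := ofCoeffs_cf p m Fq k hFq u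
  have hc := fun a => ofCoeffs_cf p m Fq k hFq (θ a)
  have hu0 : u ≠ 0 := by rintro rfl; exact hu (map_zero _)
  have hcu0 : cf p m Fq k hFq u ≠ 0 := fun h0 => hu0 (Subtype.ext (by
    rw [← hcu, h0, ofCoeffs_zero]; rfl))
  obtain ⟨l, hl, hl'⟩ := exists_lead hcu0
  have hPu := addPoly_natDegree_eq (q := Fintype.card Fq) (liftCoeffs k (cf p m Fq k hFq u)) hq1 (d := l)
    (by rw [liftCoeffs_apply]; exact (_root_.map_ne_zero _).2 hl)
    (fun i hi => by rw [liftCoeffs_apply, hl' i hi, map_zero])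
  obtain ⟨b, hb⟩ : ∃ b : Fq[X] → ℕ →₀ k, ∀ a, ofCoeffs p m Fq k hFq (b a) =
      ofCoeffs p m Fq k hFq (cf p m Fq k hFq u) * ofCoeffs p m Fq k hFq (φ.coeffs a) := by
    choose b hb using fun a => exists_ofCoeffs_mul p m Fq k hFq (cf p m Fq k hFq u) (φ.coeffs a)
    exact ⟨b, fun a => (hb a).symm⟩
  have hb' : ∀ a, ofCoeffs p m Fq k hFq (cf p m Fq k hFq (θ a)) *
      ofCoeffs p m Fq k hFq (cf p m Fq k hFq u) = ofCoeffs p m Fq k hFq (b a) := fun a => by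
    rw [hb, hc, hcu, ← φ.eq_ofCoeffs, h]
  have hdeg : ∀ a, a ≠ 0 →
      (addPoly (Fintype.card Fq) (liftCoeffs k (cf p m Fq k hFq (θ a)))).natDegree =
        Fintype.card Fq ^ (r * a.natDegree) := fun a ha => by
    have hφ := addPoly_natDegree_eq (q := Fintype.card Fq) (liftCoeffs k (φ.coeffs a)) hq1
      (d := r * a.natDegree) (by rw [liftCoeffs_apply]; exact (_root_.map_ne_zero _).2 (φ.coeff_top a ha))
      (fun i hi => by rw [liftCoeffs_apply, φ.coeff_eq_zero a i hi, map_zero])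
    have h1 := congrArg natDegree (addPoly_comp p m Fq k hFq (hb' a))
    rw [← addPoly_comp p m Fq k hFq (hb a).symm, natDegree_comp, natDegree_comp, hPu, hφ,
      mul_comm] at h1
    exact Nat.eq_of_mul_eq_mul_left (pow_pos (zero_lt_one.trans hq1) l) h1
  have hne : ∀ a, a ≠ 0 → cf p m Fq k hFq (θ a) ≠ 0 := fun a ha h0 => by
    have := hdeg a ha
    rw [(addPoly_eq_zero_iff _ hq1).2 (by rw [h0]; simp [liftCoeffs]), natDegree_zero] at this
    exact (pow_pos (zero_lt_one.trans hq1) _).ne this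
  have hlead : ∀ a, a ≠ 0 → cf p m Fq k hFq (θ a) (r * a.natDegree) ≠ 0 ∧
      ∀ i, r * a.natDegree < i → cf p m Fq k hFq (θ a) i = 0 := fun a ha => by
    obtain ⟨d, hd, hd'⟩ := exists_lead (hne a ha)
    have h1 := addPoly_natDegree_eq (q := Fintype.card Fq) (liftCoeffs k (cf p m Fq k hFq (θ a))) hq1 (d := d)
      (by rw [liftCoeffs_apply]; exact (_root_.map_ne_zero _).2 hd)
      (fun i hi => by rw [liftCoeffs_apply, hd' i hi, map_zero])
    rw [hdeg a ha] at h1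
    rw [Nat.pow_right_injective hq1 h1]
    exact ⟨hd, hd'⟩
  refine ⟨{ toRingHom := (SK).subtype.comp θ
            coeffs := fun a => cf p m Fq k hFq (θ a)
            eq_ofCoeffs := fun a => (hc a).symm
            coeff_zero := fun a => ?_
            coeff_top := fun a ha => (hlead a ha).1
            coeff_eq_zero := fun a i hi => ?_ }, fun a => rfl⟩
  · have h1 := coeff_zero_mul p m Fq k hFq (hb' a)
    rw [coeff_zero_mul p m Fq k hFq (hb a).symm, φ.coeff_zero, mul_comm] at h1
    refine (mul_right_cancel₀ ?_ h1).symm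
    rwa [← constCoeff_eq p m Fq k hFq hcu.symm]
  · by_cases ha : a = 0
    · have h0 : cf p m Fq k hFq (θ a) = 0 := by
        rw [← ofCoeffs_eq_zero_iff p m Fq k hFq, hc, ha, map_zero]; rfl
      rw [h0]; rfl
    · exact (hlead a ha).2 i hi

theorem ne_zero_of_card {n : ℕ} (hk : Fintype.card k = Fintype.card Fq ^ n) : n ≠ 0 := by
  rintro rfl
  have := Fintype.one_lt_card (α := k)
  rw [hk, pow_zero] at this
  exact lt_irrefl _ this

/-- `k{τ}` acting on an algebraic closure of `k`. -/
def skewLike (n : ℕ) (hk : Fintype.card k = Fintype.card Fq ^ n) (γ : Fq[X] →+* k) :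
    letI := skewAlgebra p m Fq k hFq n hk γ
    SkewLike Fq k SK (Kb k) :=
  letI := skewAlgebra p m Fq k hFq n hk γ
  { κ := constCoeff p m Fq k hFq
    κ_algebraMap := fun c => by
      have := constCoeff_frobHom p m Fq k hFq n γ (ne_zero_of_card Fq k hk) c
      refine (Eq.congr_left this).trans ?_
      exact map_eq_zero (γ.comp C)
    t := tauS p m Fq k hFq
    n := n
    t_pow := (frobHom_X p m Fq k hFq n γ).symm
    t_ne_zero := fun h0 => by
      have h1 := DFunLike.congr_fun (congrArg Subtype.val h0) (1 : Kb k)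
      change (1 : Kb k) ^ Fintype.card Fq = 0 at h1
      rw [one_pow] at h1
      exact one_ne_zero h1
    κ_t := constCoeff_tauS p m Fq k hFq
    pow_mul := tauS_pow_mul p m Fq k hFq
    exists_eq_mul_pow := fun _ hx => exists_eq_mul_tauS_pow p m Fq k hFq hx
    exists_eq_mul := fun _ _ hv h => exists_eq_mul_of_ker_le p m Fq k hFq hv h
    exists_kernel := fun G hG ⟨c, hc, hcG⟩ =>
      exists_kernel p m Fq k hFq n hk γ (ne_zero_of_card Fq k hk) G hG c hc hcG }

end Concrete

section Main

variable (p m n : ℕ) [Fact p.Prime] (Fq k : Type) [Field Fq] [Fintype Fq]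
  [Field k] [Fintype k] [CharP k p] (hFq : Fintype.card Fq = p ^ m)
  {γ : Polynomial Fq →+* k} {r : ℕ}

local notation "SK" => skewPoly p m Fq k hFq

/-- The criterion for an order to be an endomorphism ring, with the centralizer of `φ(A)` given
abstractly. -/
theorem locally_maximal_iff (hk : Fintype.card k = Fintype.card Fq ^ n)
    (φ : DrinfeldModule p m Fq k hFq γ r) {E D : Type} [CommRing E]
    [Field D] [Algebra E D] [IsFractionRing E D] (val : E →+* SK) (hval : Function.Injective val)
    (tE : Fq[X] →+* E) (htE : ∀ a, (val (tE a) : AddMonoid.End (Kb k)) = φ.toRingHom a) (πE : E)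
    (hπ : val πE = tauS p m Fq k hFq ^ n)
    (cent : ∀ x : SK, (∀ a, x * val (tE a) = val (tE a) * x) → ∃ e, val e = x)
    (R : Subring D) (hRA : ∀ a, algebraMap E D (tE a) ∈ R) (hRπ : algebraMap E D πE ∈ R)
    (hRint : ∀ x ∈ R, ∃ N : ℕ, 0 < N ∧ ∃ c : ℕ → Fq[X],
      x ^ N + ∑ i ∈ Finset.range N, algebraMap E D (tE (c i)) * x ^ i = 0) :
    (∃ ψ : DrinfeldModule p m Fq k hFq γ r, ∃ u : AddMonoid.End (Kb k),
        IsIsogeny p m Fq k hFq φ ψ u ∧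
        (∀ x ∈ EndRing p m Fq k hFq ψ, ∃ ρ ∈ R, ∃ e : E, ∃ a : Fq[X], a ≠ 0 ∧
          ρ * algebraMap E D (tE a) = algebraMap E D e ∧
          x * (u * φ.toRingHom a) = u * (val e : AddMonoid.End (Kb k))) ∧
        (∀ ρ ∈ R, ∃ x ∈ EndRing p m Fq k hFq ψ, ∃ e : E, ∃ a : Fq[X], a ≠ 0 ∧
          ρ * algebraMap E D (tE a) = algebraMap E D e ∧
          x * (u * φ.toRingHom a) = u * (val e : AddMonoid.End (Kb k)))) ↔
      ∀ b : D, (∃ N : ℕ, 0 < N ∧ ∃ c : ℕ → Fq[X],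
          b ^ N + ∑ i ∈ Finset.range N, algebraMap E D (tE (c i)) * b ^ i = 0) →
        ∃ g : Fq[X], g.coeff 0 ≠ 0 ∧
          b * eval₂ ((algebraMap E D).comp (tE.comp C)) (algebraMap E D πE) g ∈ R := by
  let _ := skewAlgebra p m Fq k hFq n hk γ
  have hfinS : Module.Finite Fq[X] SK := skew_finite p m Fq k hFq n hk γ (ne_zero_of_card Fq k hk)
  let H := skewLike p m Fq k hFq n hk γ
  let _ : Algebra Fq[X] E := (eval₂RingHom (tE.comp C) πE).toAlgebra
  let _ : Algebra Fq[X] D := ((algebraMap E D).comp (eval₂RingHom (tE.comp C) πE)).toAlgebra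
  have htower : IsScalarTower Fq[X] E D := IsScalarTower.of_algebraMap_eq fun _ => rfl
  have halgE : ∀ c : Fq[X], algebraMap Fq[X] E c = eval₂ (tE.comp C) πE c := fun _ => rfl
  have halgD : ∀ c : Fq[X], algebraMap Fq[X] D c =
      eval₂ ((algebraMap E D).comp (tE.comp C)) (algebraMap E D πE) c := fun c =>
    hom_eval₂ c (tE.comp C) (algebraMap E D) πE
  have hvalC : ∀ a, val (tE (C a)) = mlHom p m Fq k hFq (γ (C a)) := fun a =>
    Subtype.ext ((htE _).trans (toRingHom_C p m Fq k hFq φ a))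
  let Z : CentSetup Fq SK E :=
    { ι := { val with
        commutes' := fun c => by
          change val (eval₂ (tE.comp C) πE c) = frobHom p m Fq k hFq n γ c
          induction c using Polynomial.induction_on' with
          | add a b ha hb => rw [eval₂_add, map_add, map_add, ha, hb]
          | monomial i a =>
            rw [← C_mul_X_pow_eq_monomial, eval₂_mul, eval₂_C, eval₂_X_pow, map_mul, map_mul, map_pow,
              map_pow, frobHom_X, frobHom_C, hπ, RingHom.comp_apply, hvalC] }
      inj := hval
      tE := tE
      cent := cent }
  have hι : ∀ e, Z.ι e = val e := fun _ => rfl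
  have hfinE : Module.Finite Fq[X] E := CentSetup.finite_E (Z := Z) H
  have : IsDomain E := (IsFractionRing.injective E D).isDomain
  have htE0 : ∀ a, a ≠ 0 → tE a ≠ 0 := fun a ha h0 =>
    toRingHom_ne_zero p m Fq k hFq φ ha (by rw [← htE, h0, map_zero]; rfl)
  let f : Fq[X] →+* D := (algebraMap E D).comp tE
  have hRf : ∀ x ∈ R, f.IsIntegralElem x := fun x hx => (isIntegralElem_iff f x).1 (hRint x hx)
  have hint_of : ∀ d : D, f.IsIntegralElem d → IsIntegral Fq[X] d := fun d hd =>
    isIntegralElem_trans f (algebraMap Fq[X] D) (fun a =>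
      (IsIntegral.of_finite Fq[X] (tE a)).map (IsScalarTower.toAlgHom Fq[X] E D)) hd
  have hRP : ∀ c, algebraMap Fq[X] D c ∈ R := fun c => by
    rw [halgD]
    induction c using Polynomial.induction_on' with
    | add a b ha hb => rw [eval₂_add]; exact R.add_mem ha hb
    | monomial i a =>
      rw [eval₂_monomial]
      exact R.mul_mem (hRA (C a)) (R.pow_mem hRπ i)
  have hf_of : ∀ d : D, IsIntegral Fq[X] d → f.IsIntegralElem d := fun d hd =>
    isIntegralElem_trans (algebraMap Fq[X] D) f (fun a => hRf _ (hRP a)) hd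
  have hrel : ∀ (u x : SK) (ρ : D) (e : E) (a : Fq[X]), a ≠ 0 →
      ρ * algebraMap E D (tE a) = algebraMap E D e → x * (u * val (tE a)) = u * val e →
      Z.Rel u ρ x := fun u x ρ e a ha h1 h2 => by
    obtain ⟨c, hc, y, hy⟩ := (IsIntegral.of_finite Fq[X] (tE a)).isAlgebraic.exists_nonzero_dvd
      (mem_nonZeroDivisors_of_ne_zero (htE0 a ha))
    refine ⟨e * y, c, hc, ?_, ?_⟩
    · rw [CentSetup.algebraMap_poly (E := E), hy, map_mul, map_mul, ← mul_assoc, h1]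
    · rw [← CentSetup.ι_algebraMap (Z := Z), hy, map_mul, map_mul, hι, hι, hι, mul_assoc x,
        ← mul_assoc u, ← mul_assoc x, h2, mul_assoc]
  have hwit : ∀ ρ : D, ∃ (e : E) (a : Fq[X]), a ≠ 0 ∧
      ρ * algebraMap E D (tE a) = algebraMap E D e := fun ρ => by
    obtain ⟨x, y, hy, rfl⟩ := IsFractionRing.div_surjective (A := E) ρ
    obtain ⟨P, hP, hPy⟩ := hf_of (algebraMap E D y)
      ((IsIntegral.of_finite Fq[X] y).map (IsScalarTower.toAlgHom Fq[X] E D))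
    let _ : Algebra Fq[X] E := tE.toAlgebra
    have hy' : IsIntegral Fq[X] y := by
      refine ⟨P, hP, IsFractionRing.injective E D ?_⟩
      rw [map_zero, ← hPy, hom_eval₂]
      rfl
    obtain ⟨a, ha, w, hw⟩ := hy'.isAlgebraic.exists_nonzero_dvd hy
    refine ⟨x * w, a, ha, ?_⟩
    have hy0 : algebraMap E D y ≠ 0 := IsFractionRing.to_map_ne_zero_of_mem_nonZeroDivisors hy
    rw [show tE a = y * w from hw, map_mul, map_mul, ← mul_assoc, div_mul_cancel₀ _ hy0]
  have hwit' : ∀ (u x : SK) (ρ : D), Z.Rel u ρ x → ∃ (e : E) (a : Fq[X]), a ≠ 0 ∧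
      ρ * algebraMap E D (tE a) = algebraMap E D e ∧
        (x : AddMonoid.End (Kb k)) * (u * φ.toRingHom a) = u * (val e : AddMonoid.End (Kb k)) :=
    fun u x ρ h => by
      obtain ⟨e, a, ha, hea⟩ := hwit ρ
      refine ⟨e, a, ha, hea, ?_⟩
      rw [← htE, ← mul_assoc]
      exact congrArg Subtype.val (h.apply H hea)
  constructor
  · rintro ⟨ψ, u, ⟨hu0, huS, hu⟩, hψR, -⟩ b hb
    obtain ⟨g, hg, hgR⟩ := CentSetup.locally_maximal (Z := Z) (D := D) (u := ⟨u, huS⟩) H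
      (fun h0 => hu0 (congrArg Subtype.val h0)) (fun a => ⟨ψ.toRingHom a, toRingHom_mem p m Fq k hFq ψ a⟩)
      (fun a => Subtype.ext ((congrArg (u * ·) (htE a)).trans (hu a))) R
      (fun x hx => by
        obtain ⟨ρ, hρ, e, a, ha, h1, h2⟩ := hψR x ⟨x.2, by
          rw [SetLike.mem_coe, Subring.mem_centralizer_iff]
          rintro _ ⟨a, rfl⟩
          exact (congrArg Subtype.val (hx a)).symm⟩
        refine ⟨ρ, hρ, hrel _ _ _ e a ha h1 (Subtype.ext ?_)⟩
        rw [← htE] at h2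
        exact h2)
      (hint_of b ((isIntegralElem_iff f b).1 hb))
    exact ⟨g, hg, by rwa [← halgD]⟩
  · intro hloc
    obtain ⟨u, hu, θ, hθ, hθc⟩ := CentSetup.exists_order (Z := Z) H R hRP hRA
      (fun ρ hρ => hint_of ρ (hRf ρ hρ)) (fun d hd => by
        obtain ⟨g, hg, hgR⟩ := hloc d ((isIntegralElem_iff f d).2 (hf_of d hd))
        exact ⟨g, hg, by rwa [halgD]⟩)
    have hu0 : u ≠ 0 := by rintro rfl; exact hu (map_zero _)
    have hθA : ∀ a, θ ⟨_, hRA a⟩ * u = u * val (tE a) := fun a => by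
      have := (hθ ⟨_, hRA a⟩).apply H (e₁ := tE a) (e₂ := 1) (by rw [map_one, mul_one])
      rwa [map_one, mul_one] at this
    have hθA' : ∀ a, (θ ⟨_, hRA a⟩ : AddMonoid.End (Kb k)) * u = u * φ.toRingHom a := fun a => by
      rw [← htE]
      exact congrArg Subtype.val (hθA a)
    obtain ⟨ψ, hψ⟩ := exists_drinfeldModule p m Fq k hFq φ hu (θ.comp (f.codRestrict R hRA)) hθA'
    have hψ' : ∀ a, ψ.toRingHom a = θ ⟨_, hRA a⟩ := hψ
    refine ⟨ψ, u, ⟨fun h0 => hu0 (Subtype.ext h0), u.2, fun a => by rw [hψ', hθA']⟩, ?_, ?_⟩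
    · rintro x ⟨hxS, hxc⟩
      rw [SetLike.mem_coe, Subring.mem_centralizer_iff] at hxc
      obtain ⟨ρ, hρ, hρx⟩ := hθc ⟨x, hxS⟩ fun a => Subtype.ext (by
        have := hxc _ ⟨a, rfl⟩
        rw [hψ'] at this
        exact this.symm)
      obtain ⟨e, a, h⟩ := hwit' _ _ _ hρx
      exact ⟨ρ, hρ, e, a, h⟩
    · intro ρ hρ
      obtain ⟨e, a, h⟩ := hwit' _ _ _ (hθ ⟨ρ, hρ⟩)
      refine ⟨θ ⟨ρ, hρ⟩, ⟨(θ ⟨ρ, hρ⟩).2, ?_⟩, e, a, h⟩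
      rw [SetLike.mem_coe, Subring.mem_centralizer_iff]
      rintro _ ⟨a, rfl⟩
      rw [hψ']
      have : θ ⟨_, hRA a⟩ * θ ⟨ρ, hρ⟩ = θ ⟨ρ, hρ⟩ * θ ⟨_, hRA a⟩ := by
        rw [← map_mul, mul_comm, map_mul]
      exact congrArg Subtype.val this

end Main

end Drinfeld

namespace Drinfeld

set_option synthInstance.maxHeartbeats 2000000 in
set_option maxHeartbeats 4000000 in
/-- **Proposition porism.** Let `φ` be a Drinfeld module over `k = 𝔽_{q^n}`
with `E = End_k(φ)` commutative, and let `D = E ⊗_A F = Frac(E)`.  Let `R` be an `A`-order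
in `D` containing `π = τ^n` (a subring of `D` containing the images of `A` and `π`, all of
whose elements are integral over `A`, and which spans `D` over `F`).  Then there exist a
Drinfeld module `ψ` over `k` and an isogeny `u : φ → ψ` with `u⁻¹ · End_k(ψ) · u = R`
(the relation `x = u ρ u⁻¹` for `x ∈ k{τ}`, `ρ ∈ D` being encoded via fractions
`ρ = e/φ_a`) if and only if `R` is locally maximal at `π` (equivalently: for every `b ∈ D`
integral over `A` there is `s = g(π) ∈ 𝔽_q[π] ∖ (π)`, i.e. `g(0) ≠ 0`, with `s·b ∈ R`). -/
theorem statement18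
    (p m n : ℕ) [Fact p.Prime] (Fq k : Type) [Field Fq] [Fintype Fq]
    [Field k] [Fintype k] [CharP k p] (hFq : Fintype.card Fq = p ^ m)
    (hk : Fintype.card k = Fintype.card Fq ^ n)
    (γ : Polynomial Fq →+* k) (r : ℕ) (φ : DrinfeldModule p m Fq k hFq γ r)
    (hcomm : ∀ x ∈ EndRing p m Fq k hFq φ, ∀ y ∈ EndRing p m Fq k hFq φ, x * y = y * x)
    (hπ : tau p m Fq k hFq ^ n ∈ EndRing p m Fq k hFq φ) :
    letI : CommRing ↥(EndRing p m Fq k hFq φ) := endCommRing p m Fq k hFq φ hcomm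
    ∀ R : Subring (FractionRing ↥(EndRing p m Fq k hFq φ)),
      (∀ a : Polynomial Fq,
          algebraMap ↥(EndRing p m Fq k hFq φ) (FractionRing ↥(EndRing p m Fq k hFq φ))
            (toEnd p m Fq k hFq φ a) ∈ R) →
      algebraMap ↥(EndRing p m Fq k hFq φ) (FractionRing ↥(EndRing p m Fq k hFq φ))
          (⟨tau p m Fq k hFq ^ n, hπ⟩ : ↥(EndRing p m Fq k hFq φ)) ∈ R →
      (∀ x ∈ R, ∃ N : ℕ, 0 < N ∧ ∃ c : ℕ → Polynomial Fq,
          x ^ N + ∑ i ∈ Finset.range N,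
            algebraMap ↥(EndRing p m Fq k hFq φ) (FractionRing ↥(EndRing p m Fq k hFq φ))
              (toEnd p m Fq k hFq φ (c i)) * x ^ i = 0) →
      (∀ x : FractionRing ↥(EndRing p m Fq k hFq φ), ∃ a : Polynomial Fq, a ≠ 0 ∧
          x * algebraMap ↥(EndRing p m Fq k hFq φ) (FractionRing ↥(EndRing p m Fq k hFq φ))
            (toEnd p m Fq k hFq φ a) ∈ R) →
      ((∃ ψ : DrinfeldModule p m Fq k hFq γ r, ∃ u : AddMonoid.End (Kb k),
          IsIsogeny p m Fq k hFq φ ψ u ∧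
          (∀ x ∈ EndRing p m Fq k hFq ψ, ∃ ρ ∈ R, ∃ e : ↥(EndRing p m Fq k hFq φ),
            ∃ a : Polynomial Fq, a ≠ 0 ∧
              ρ * algebraMap ↥(EndRing p m Fq k hFq φ)
                  (FractionRing ↥(EndRing p m Fq k hFq φ)) (toEnd p m Fq k hFq φ a) =
                algebraMap ↥(EndRing p m Fq k hFq φ)
                  (FractionRing ↥(EndRing p m Fq k hFq φ)) e ∧
              x * (u * φ.toRingHom a) = u * (e : AddMonoid.End (Kb k))) ∧
          (∀ ρ ∈ R, ∃ x ∈ EndRing p m Fq k hFq ψ, ∃ e : ↥(EndRing p m Fq k hFq φ),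
            ∃ a : Polynomial Fq, a ≠ 0 ∧
              ρ * algebraMap ↥(EndRing p m Fq k hFq φ)
                  (FractionRing ↥(EndRing p m Fq k hFq φ)) (toEnd p m Fq k hFq φ a) =
                algebraMap ↥(EndRing p m Fq k hFq φ)
                  (FractionRing ↥(EndRing p m Fq k hFq φ)) e ∧
              x * (u * φ.toRingHom a) = u * (e : AddMonoid.End (Kb k)))) ↔
        (∀ b : FractionRing ↥(EndRing p m Fq k hFq φ),
          (∃ N : ℕ, 0 < N ∧ ∃ c : ℕ → Polynomial Fq,
            b ^ N + ∑ i ∈ Finset.range N,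
              algebraMap ↥(EndRing p m Fq k hFq φ) (FractionRing ↥(EndRing p m Fq k hFq φ))
                (toEnd p m Fq k hFq φ (c i)) * b ^ i = 0) →
          ∃ g : Polynomial Fq, g.coeff 0 ≠ 0 ∧
            b * Polynomial.eval₂
              ((algebraMap ↥(EndRing p m Fq k hFq φ)
                  (FractionRing ↥(EndRing p m Fq k hFq φ))).comp
                ((toEnd p m Fq k hFq φ).comp Polynomial.C))
              (algebraMap ↥(EndRing p m Fq k hFq φ)
                (FractionRing ↥(EndRing p m Fq k hFq φ))
                (⟨tau p m Fq k hFq ^ n, hπ⟩ : ↥(EndRing p m Fq k hFq φ))) g ∈ R)) := by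
  intro R hRA hRπ hRint _
  let _ : CommRing ↥(EndRing p m Fq k hFq φ) := endCommRing p m Fq k hFq φ hcomm
  let val : ↥(EndRing p m Fq k hFq φ) →+* ↥(skewPoly p m Fq k hFq) :=
    Subring.inclusion inf_le_left
  have hval : Function.Injective val := Subring.inclusion_injective _
  have : IsDomain ↥(EndRing p m Fq k hFq φ) := hval.isDomain val
  exact locally_maximal_iff p m n Fq k hFq hk φ val hval (toEnd p m Fq k hFq φ) (fun _ => rfl)
    ⟨tau p m Fq k hFq ^ n, hπ⟩ (Subtype.ext rfl)
    (fun x hx => ⟨⟨x, x.2, by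
      rw [SetLike.mem_coe, Subring.mem_centralizer_iff]
      rintro _ ⟨a, rfl⟩
      exact (congrArg Subtype.val (hx a)).symm⟩, rfl⟩) R hRA hRπ hRint

end Drinfeld
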